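/- Let 𝒜 be a C*-algebra and let (ρ_i, H_i)_{i∈I} be a maximal family of pairwise unitarily inequivalent irreducible *-representations of 𝒜 (i.e. no two ρ_i are unitarily equivalent and every irreducible *-representation of 𝒜 is unitarily equivalent to some ρ_i); let ρ = ⊕_{i∈I} ρ_i acting on H = ⊕_{i∈I} H_i (the reduced atomic representation of 𝒜). Let a ∈ 𝒜 and let 𝔦 be a Calkin space such that the sequence (dₙ(M_{a,a}))_{n≥1} of Kolmogorov numbers of M_{a,a} : 𝒜 → 𝒜 belongs to 𝔦. Then ρ(a) is a compact operator on H and the sequence (sₙ(ρ(a))²)_{n≥1} belongs to 𝔦. -/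

import Mathlib

open scoped BigOperators

noncomputable section

/-- The space of complex null sequences `c₀`. -/
def c0 : Set (ℕ → ℂ) := {α | Filter.Tendsto α Filter.atTop (nhds 0)}

/-- `rearrSum α n` is the supremum of `∑_{i ∈ F} |α i|` over finite sets `F ⊆ ℕ` with
`|F| = n`; for a null sequence it equals `α*₁ + ⋯ + α*ₙ` where `α*` is the decreasing
rearrangement of `(|α_n|)`. -/
def rearrSum (α : ℕ → ℂ) (n : ℕ) : ℝ :=
  sSup ((fun F : Finset ℕ => ∑ i ∈ F, ‖α i‖) '' {F | F.card = n})

/-- The decreasing rearrangement of a null sequence, 0-indexed: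
`rearr α n = α*_{n+1}`. -/
def rearr (α : ℕ → ℂ) (n : ℕ) : ℝ := rearrSum α (n + 1) - rearrSum α n

/-- A Calkin space: a linear subspace of `c₀` containing every null sequence whose
decreasing rearrangement is dominated termwise by that of one of its members. -/
def IsCalkinSpace (I : Set (ℕ → ℂ)) : Prop :=
  I ⊆ c0 ∧ (0 : ℕ → ℂ) ∈ I ∧
  (∀ α ∈ I, ∀ β ∈ I, α + β ∈ I) ∧
  (∀ (c : ℂ), ∀ α ∈ I, c • α ∈ I) ∧
  (∀ α ∈ I, ∀ β ∈ c0, (∀ n, rearr β n ≤ rearr α n) → β ∈ I)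

/-- `tensorSum α β n` is the supremum of `∑_{(i,j) ∈ F} |α i| |β j|` over finite
`F ⊆ ℕ × ℕ` with `|F| = n`; it equals `(α⊗β)₁ + ⋯ + (α⊗β)ₙ`. -/
def tensorSum (α β : ℕ → ℂ) (n : ℕ) : ℝ :=
  sSup ((fun F : Finset (ℕ × ℕ) => ∑ p ∈ F, ‖α p.1‖ * ‖β p.2‖) '' {F | F.card = n})

/-- The tensor sequence `α⊗β`: the decreasing rearrangement of the double sequence
`(|α_m β_n|)_{m,n}`, 0-indexed: `tensorSeq α β n = (α⊗β)_{n+1}`. -/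
def tensorSeq (α β : ℕ → ℂ) (n : ℕ) : ℝ := tensorSum α β (n + 1) - tensorSum α β n

/-- Embedding of real sequences into complex sequences. -/
def toC (f : ℕ → ℝ) : ℕ → ℂ := fun n => (f n : ℂ)

/-- The tensor product `𝔦⊗𝔧` of two Calkin spaces: the smallest Calkin space
containing `α⊗β` for all `α ∈ 𝔦`, `β ∈ 𝔧`. -/
def calkinTensor (I J : Set (ℕ → ℂ)) : Set (ℕ → ℂ) :=
  ⋂₀ {K | IsCalkinSpace K ∧ ∀ α ∈ I, ∀ β ∈ J, toC (tensorSeq α β) ∈ K}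

/-- A Calkin space `𝔦` is stable if `𝔦⊗𝔦 = 𝔦`. -/
def IsStableCalkin (I : Set (ℕ → ℂ)) : Prop := IsCalkinSpace I ∧ calkinTensor I I = I

/-- The principal Calkin space `⟨α⟩` generated by `α`: the smallest Calkin space
containing `α`. -/
def principalCalkin (α : ℕ → ℂ) : Set (ℕ → ℂ) := ⋂₀ {K | IsCalkinSpace K ∧ α ∈ K}

/-- `Kw ω α n = #{m : ω^{n+1} < α m ≤ ω^n}` (the sequence `α` being 0-indexed). -/
def Kw (ω : ℝ) (α : ℕ → ℝ) (n : ℕ) : ℕ :=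
  Set.ncard {m : ℕ | ω ^ (n + 1) < α m ∧ α m ≤ ω ^ n}

/-- `K̃ₙ = Σ_{i=0}^n Kᵢ`. -/
def Ktil (ω : ℝ) (α : ℕ → ℝ) (n : ℕ) : ℕ := ∑ i ∈ Finset.range (n + 1), Kw ω α i

/-- `Mₙ = Σ_{i+j=n} Kᵢ Kⱼ`. -/
def Mw (ω : ℝ) (α : ℕ → ℝ) (n : ℕ) : ℕ :=
  ∑ i ∈ Finset.range (n + 1), Kw ω α i * Kw ω α (n - i)

/-- `M̃ₙ = Σ_{i=0}^n Mᵢ`. -/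
def Mtil (ω : ℝ) (α : ℕ → ℝ) (n : ℕ) : ℕ := ∑ i ∈ Finset.range (n + 1), Mw ω α i

/-- The `n`-th approximation number of `T` (1-indexed: `approxNum T n = aₙ(T)` is the
infimum of `‖T - F‖` over bounded operators `F` of rank `< n`).  For operators between
Hilbert spaces this equals the `n`-th singular number. -/
def approxNum {X Y : Type*} [NormedAddCommGroup X] [NormedSpace ℂ X]
    [NormedAddCommGroup Y] [NormedSpace ℂ Y] (T : X →L[ℂ] Y) (n : ℕ) : ℝ :=
  sInf {c | ∃ F : X →L[ℂ] Y, LinearMap.rank (F : X →ₗ[ℂ] Y) < (n : Cardinal) ∧ c = ‖T - F‖}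

/-- The `n`-th Kolmogorov number `dₙ(T)` (1-indexed). -/
def kolNum {X Y : Type*} [NormedAddCommGroup X] [NormedSpace ℂ X]
    [NormedAddCommGroup Y] [NormedSpace ℂ Y] (T : X →L[ℂ] Y) (n : ℕ) : ℝ :=
  sInf {c | ∃ V : Submodule ℂ Y, Module.rank ℂ V < (n : Cardinal) ∧
    c = ⨆ x : {x : X // ‖x‖ ≤ 1}, ⨅ y : V, ‖T x.1 - (y : Y)‖}

/-- The `n`-th Hilbert number `hₙ(T)` (1-indexed): the supremum of `sₙ(A ∘ T ∘ B)` over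
all Hilbert spaces `K`, `H'` and all contractions `B : K → X`, `A : Y → H'`. -/
def hilbertNum {X Y : Type u} [NormedAddCommGroup X] [NormedSpace ℂ X]
    [NormedAddCommGroup Y] [NormedSpace ℂ Y] (T : X →L[ℂ] Y) (n : ℕ) : ℝ :=
  sSup {c | ∃ (K : Type u) (_ : NormedAddCommGroup K) (_ : InnerProductSpace ℂ K)
    (_ : CompleteSpace K) (H' : Type u) (_ : NormedAddCommGroup H')
    (_ : InnerProductSpace ℂ H') (_ : CompleteSpace H')
    (B : K →L[ℂ] X) (A : Y →L[ℂ] H'), ‖B‖ ≤ 1 ∧ ‖A‖ ≤ 1 ∧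
    c = approxNum ((A.comp T).comp B) n}

/-- The sequence of singular numbers of an operator, 0-indexed:
`sSeq T n = s_{n+1}(T) = a_{n+1}(T)`. -/
def sSeq {X Y : Type*} [NormedAddCommGroup X] [NormedSpace ℂ X]
    [NormedAddCommGroup Y] [NormedSpace ℂ Y] (T : X →L[ℂ] Y) : ℕ → ℝ :=
  fun n => approxNum T (n + 1)

/-- The multiplication operator `M_{a,b} : x ↦ a * x * b` on a normed algebra. -/
def Mop {A : Type*} [NonUnitalNormedRing A] [NormedSpace ℂ A] [IsScalarTower ℂ A A]
    [SMulCommClass ℂ A A] (a b : A) : A →L[ℂ] A :=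
  (ContinuousLinearMap.mul ℂ A a).comp ((ContinuousLinearMap.mul ℂ A).flip b)

theorem rearrSum_bdd (α : ℕ → ℂ) (hα : α ∈ c0) (n : ℕ) :
    BddAbove ((fun F : Finset ℕ => ∑ i ∈ F, ‖α i‖) '' {F | F.card = n}) := by
  have hα' : Filter.Tendsto α Filter.atTop (nhds 0) := hα
  obtain ⟨C, hC⟩ := hα'.norm.bddAbove_range
  refine ⟨n * C, ?_⟩
  rintro _ ⟨F, hF, rfl⟩
  have hF' : F.card = n := hF
  have := Finset.sum_le_card_nsmul F (fun i => ‖α i‖) C (fun i _ => hC ⟨i, rfl⟩)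
  rw [hF', nsmul_eq_mul] at this
  exact this

theorem rearrSum_nonempty (α : ℕ → ℂ) (n : ℕ) :
    ((fun F : Finset ℕ => ∑ i ∈ F, ‖α i‖) '' {F | F.card = n}).Nonempty :=
  ⟨_, Finset.range n, Finset.card_range n, rfl⟩

/-- Spreading a sequence along an injection does not change the rearrangement. -/
theorem rearrSum_spread (α β : ℕ → ℂ) (hα : α ∈ c0) (hβ : β ∈ c0) (φ : ℕ → ℕ)
    (hφ : Function.Injective φ) (h1 : ∀ n, β (φ n) = α n) (h2 : ∀ m, m ∉ Set.range φ → β m = 0)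
    (n : ℕ) : rearrSum β n = rearrSum α n := by
  classical
  apply le_antisymm
  · refine csSup_le (rearrSum_nonempty β n) ?_
    rintro _ ⟨F, hF, rfl⟩
    have hF' : F.card = n := hF
    let G := F.preimage φ hφ.injOn
    have hG : G.card ≤ n := by
      rw [← hF', ← Finset.card_image_of_injective G hφ]
      refine Finset.card_le_card ?_
      intro m hm
      obtain ⟨k, hk, rfl⟩ := Finset.mem_image.1 hm
      exact Finset.mem_preimage.1 hk
    obtain ⟨G', hGG', hG'⟩ := Infinite.exists_superset_card_eq G n hG
    have e : ∑ i ∈ F, ‖β i‖ = ∑ k ∈ G, ‖α k‖ := by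
      rw [← Finset.sum_preimage φ F hφ.injOn (fun i => ‖β i‖)
        (fun x _ hx => by simp [h2 x hx])]
      simp only [h1, G]
    refine le_csSup_of_le (rearrSum_bdd α hα n) ⟨G', hG', rfl⟩ ?_
    change ∑ i ∈ F, ‖β i‖ ≤ ∑ k ∈ G', ‖α k‖
    rw [e]
    exact Finset.sum_le_sum_of_subset_of_nonneg hGG' fun _ _ _ => norm_nonneg _
  · refine csSup_le (rearrSum_nonempty α n) ?_
    rintro _ ⟨F, hF, rfl⟩
    have hF' : F.card = n := hF
    refine le_csSup_of_le (rearrSum_bdd β hβ n)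
      ⟨F.image φ, (Finset.card_image_of_injective F hφ).trans hF', rfl⟩ ?_
    change ∑ i ∈ F, ‖α i‖ ≤ ∑ i ∈ F.image φ, ‖β i‖
    rw [Finset.sum_image hφ.injOn]
    simp [h1]

theorem calkin_spread (J : Set (ℕ → ℂ)) (hJ : IsCalkinSpace J) (α β : ℕ → ℂ) (hα : α ∈ J)
    (hβ : β ∈ c0) (φ : ℕ → ℕ)
    (hφ : Function.Injective φ) (h1 : ∀ n, β (φ n) = α n)
    (h2 : ∀ m, m ∉ Set.range φ → β m = 0) : β ∈ J := by
  refine hJ.2.2.2.2 α hα β hβ fun n => ?_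
  unfold rearr
  rw [rearrSum_spread α β (hJ.1 hα) hβ φ hφ h1 h2, rearrSum_spread α β (hJ.1 hα) hβ φ hφ h1 h2]

theorem tendsto_half {α : ℕ → ℂ} (hα : α ∈ c0) :
    Filter.Tendsto (fun n => α (n / 2)) Filter.atTop (nhds 0) := by
  have hα' : Filter.Tendsto α Filter.atTop (nhds 0) := hα
  exact hα'.comp (Nat.tendsto_div_const_atTop (by norm_num))

theorem calkin_dilate (J : Set (ℕ → ℂ)) (hJ : IsCalkinSpace J) (α : ℕ → ℂ) (hα : α ∈ J) :
    (fun n => α (n / 2)) ∈ J := by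
  have ht := tendsto_half (hJ.1 hα)
  have he : (fun n : ℕ => if n % 2 = 0 then α (n / 2) else 0) ∈ J := by
    refine calkin_spread J hJ α _ hα ?_ (fun n => 2 * n) (fun a b h => by simpa using h) ?_ ?_
    · refine squeeze_zero_norm (fun n => ?_) (tendsto_zero_iff_norm_tendsto_zero.1 ht)
      split_ifs <;> simp
    · intro n; simp
    · intro m hm
      rw [if_neg]
      intro h
      exact hm ⟨m / 2, by simp only; omega⟩
  have ho : (fun n : ℕ => if n % 2 = 1 then α (n / 2) else 0) ∈ J := by
    refine calkin_spread J hJ α _ hα ?_ (fun n => 2 * n + 1) (fun a b h => by simpa using h) ?_ ?_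
    · refine squeeze_zero_norm (fun n => ?_) (tendsto_zero_iff_norm_tendsto_zero.1 ht)
      split_ifs <;> simp
    · intro n
      have : (2 * n + 1) % 2 = 1 := by omega
      have h' : (2 * n + 1) / 2 = n := by omega
      simp [this, h']
    · intro m hm
      rw [if_neg]
      intro h
      exact hm ⟨m / 2, by simp only; omega⟩
  have := hJ.2.2.1 _ he _ ho
  convert this using 1
  funext n
  rcases Nat.mod_two_eq_zero_or_one n with h | h <;> simp [h]

theorem sum_le_sum_range_of_antitone (f : ℕ → ℝ) (hf : Antitone f) (F : Finset ℕ) :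
    ∑ i ∈ F, f i ≤ ∑ i ∈ Finset.range F.card, f i := by
  classical
  induction F using Finset.induction_on_max with
  | empty => simp
  | insert a s hs ih =>
    have ha : a ∉ s := fun h => lt_irrefl _ (hs a h)
    rw [Finset.sum_insert ha, Finset.card_insert_of_notMem ha, Finset.sum_range_succ]
    have hcard : s.card ≤ a := by
      have : s ⊆ Finset.range a := fun x hx => Finset.mem_range.2 (hs x hx)
      simpa using Finset.card_le_card this
    linarith [hf hcard]

theorem rearr_antitone (f : ℕ → ℝ) (hf : Antitone f) (h0 : ∀ n, 0 ≤ f n) (n : ℕ) :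
    rearr (toC f) n = f n := by
  have hn : ∀ i, ‖toC f i‖ = f i := fun i => by simp [toC, abs_of_nonneg (h0 i)]
  have key : ∀ n, rearrSum (toC f) n = ∑ i ∈ Finset.range n, f i := by
    intro n
    have hle : ∀ x ∈ ((fun F : Finset ℕ => ∑ i ∈ F, ‖toC f i‖) '' {F | F.card = n}),
        x ≤ ∑ i ∈ Finset.range n, f i := by
      rintro _ ⟨F, hF, rfl⟩
      have hF' : F.card = n := hF
      simp only [hn]
      rw [← hF']
      exact sum_le_sum_range_of_antitone f hf F
    apply le_antisymm
    · exact csSup_le (rearrSum_nonempty _ n) hle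
    · exact le_csSup ⟨_, hle⟩ ⟨Finset.range n, Finset.card_range n, by simp [hn]⟩
  unfold rearr
  rw [key, key, Finset.sum_range_succ]
  ring

/-- Membership criterion used in the main theorem. -/
theorem calkin_mem_of_half (J : Set (ℕ → ℂ)) (hJ : IsCalkinSpace J) (d s : ℕ → ℝ)
    (hd : toC d ∈ J) (hda : Antitone d) (hd0 : ∀ n, 0 ≤ d n) (hs : Antitone s)
    (hs0 : ∀ n, 0 ≤ s n) (h : ∀ n, s n ≤ 2 * d (n / 2)) : toC s ∈ J := by
  have h1 : toC (fun n => 2 * d (n / 2)) ∈ J := by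
    have := hJ.2.2.2.1 2 _ (calkin_dilate J hJ _ hd)
    convert this using 1
    funext n
    simp [toC]
  have hc := hJ.1 h1
  refine hJ.2.2.2.2 _ h1 _ ?_ fun n => ?_
  · have hc' : Filter.Tendsto (toC fun n => 2 * d (n / 2)) Filter.atTop (nhds 0) := hc
    refine squeeze_zero_norm (fun n => ?_) (tendsto_zero_iff_norm_tendsto_zero.1 hc')
    simp only [toC, Complex.norm_real, Real.norm_eq_abs]
    rw [abs_of_nonneg (hs0 n)]
    exact (h n).trans (le_abs_self _)
  · rw [rearr_antitone s hs hs0, rearr_antitone _ _ _]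
    · exact h n
    · intro a b hab
      have := hda (Nat.div_le_div_right (c := 2) hab)
      simp only
      linarith
    · intro n
      have := hd0 (n / 2)
      linarith
/-- Amplification of an operator. -/
def ampl {ι H : Type*} [Fintype ι] [NormedAddCommGroup H] [InnerProductSpace ℂ H]
    (S : H →L[ℂ] H) (e : PiLp 2 (fun _ : ι => H)) : PiLp 2 (fun _ : ι => H) :=
  WithLp.toLp 2 (fun j => S (e j))

/-- Algebraic form of the density theorem. -/
theorem density_functional {𝒜 : Type*} [NonUnitalCStarAlgebra 𝒜]
    {H : Type*} [NormedAddCommGroup H] [InnerProductSpace ℂ H] [CompleteSpace H]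
    (ρ : 𝒜 →⋆ₙₐ[ℂ] (H →L[ℂ] H)) (hnd : ∀ v : H, (∀ x, ρ x v = 0) → v = 0)
    (B : H →L[ℂ] H) (hB : ∀ C : H →L[ℂ] H, (∀ x, Commute (ρ x) C) → Commute B C)
    {ι : Type*} [Fintype ι] (z w : ι → H)
    (h : ∀ y : 𝒜, ∑ j, inner ℂ (z j) (ρ y (w j)) = 0) :
    ∑ j, inner ℂ (z j) (B (w j)) = 0 := by
  classical
  let w' : PiLp 2 (fun _ : ι => H) := WithLp.toLp 2 w
  let z' : PiLp 2 (fun _ : ι => H) := WithLp.toLp 2 z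
  let N : Submodule ℂ (PiLp 2 (fun _ : ι => H)) :=
    { carrier := Set.range (fun y : 𝒜 => ampl (ρ y) w')
      add_mem' := by
        rintro _ _ ⟨x, rfl⟩ ⟨y, rfl⟩
        exact ⟨x + y, by ext j; simp [ampl]⟩
      zero_mem' := ⟨0, by ext j; simp [ampl]⟩
      smul_mem' := by
        rintro c _ ⟨x, rfl⟩
        exact ⟨c • x, by ext j; simp [ampl]⟩ }
  have hcont : ∀ S : H →L[ℂ] H, Continuous (ampl (ι := ι) S) := by
    intro S
    unfold ampl
    fun_prop
  have hinner : ∀ (y : 𝒜) (e f : PiLp 2 (fun _ : ι => H)),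
      inner ℂ e (ampl (ρ y) f) = inner ℂ (ampl (ρ (star y)) e) f := by
    intro y e f
    simp only [PiLp.inner_apply, ampl, map_star]
    refine Finset.sum_congr rfl fun j _ => ?_
    rw [ContinuousLinearMap.star_eq_adjoint, ContinuousLinearMap.adjoint_inner_left]
  let M := N.topologicalClosure
  have hMc : IsClosed (M : Set (PiLp 2 (fun _ : ι => H))) := N.isClosed_topologicalClosure
  have : CompleteSpace M := hMc.completeSpace_coe
  have hNM : N ≤ M := N.le_topologicalClosure
  have hNinv : ∀ (y : 𝒜) (e), e ∈ N → ampl (ρ y) e ∈ N := by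
    rintro y _ ⟨x, rfl⟩
    exact ⟨y * x, by ext j; simp [ampl]⟩
  have hMinv : ∀ (y : 𝒜) (e), e ∈ M → ampl (ρ y) e ∈ M := by
    intro y e he
    exact map_mem_closure (hcont _) he (fun e he => hNinv y e he)
  have hMo : ∀ (y : 𝒜) (e), e ∈ Mᗮ → ampl (ρ y) e ∈ Mᗮ := by
    intro y e he
    rw [Submodule.mem_orthogonal] at he ⊢
    intro u hu
    rw [hinner]
    exact he _ (hMinv _ _ hu)
  let P := M.starProjection
  have hPmem : ∀ e, P e ∈ M := fun e => by simp [P]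
  have hPo : ∀ e, e - P e ∈ Mᗮ := fun e => M.sub_starProjection_mem_orthogonal e
  have hsub : ∀ (S : H →L[ℂ] H) (e f : PiLp 2 (fun _ : ι => H)),
      ampl S (e - f) = ampl S e - ampl S f := by
    intro S e f; ext j; simp [ampl]
  have hPcomm : ∀ (y : 𝒜) (e), P (ampl (ρ y) e) = ampl (ρ y) (P e) := by
    intro y e
    refine Submodule.eq_starProjection_of_mem_orthogonal (hMinv _ _ (hPmem e)) ?_
    rw [← hsub]
    exact hMo _ _ (hPo e)
  -- `w' ∈ M`
  have hw : P w' = w' := by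
    have h0 : ∀ y : 𝒜, ampl (ρ y) (w' - P w') = 0 := by
      intro y
      rw [hsub, ← hPcomm, sub_eq_zero]
      exact (Submodule.starProjection_eq_self_iff.2 (hNM ⟨y, rfl⟩)).symm
    have : w' - P w' = 0 := by
      ext j
      refine hnd _ fun y => ?_
      have := congrArg (fun e : PiLp 2 (fun _ : ι => H) => e j) (h0 y)
      simpa [ampl] using this
    exact (sub_eq_zero.1 this).symm
  -- matrix entries
  let inj : ι → H →L[ℂ] PiLp 2 (fun _ : ι => H) := fun k =>
    ((PiLp.continuousLinearEquiv 2 ℂ (fun _ : ι => H)).symm :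
      _ →L[ℂ] PiLp 2 (fun _ : ι => H)).comp (ContinuousLinearMap.single ℂ (fun _ : ι => H) k)
  let C : ι → ι → H →L[ℂ] H := fun j k => (PiLp.proj 2 (fun _ : ι => H) j).comp (P.comp (inj k))
  have hinj : ∀ (S : H →L[ℂ] H) k v, inj k (S v) = ampl S (inj k v) := by
    intro S k v
    ext j
    by_cases hjk : j = k
    · subst hjk; simp [inj, ampl]
    · simp [inj, ampl, hjk]
  have hC : ∀ j k x, Commute (ρ x) (C j k) := by
    intro j k x
    ext v
    simp only [mul_apply_eq_comp, C, ContinuousLinearMap.comp_apply]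
    rw [hinj, hPcomm]
    simp [ampl]
  have hsum : ∀ e : PiLp 2 (fun _ : ι => H), e = ∑ k, inj k (e k) := by
    intro e
    ext j
    simp [inj, Finset.sum_apply, Pi.single_apply]
  have hPe : ∀ (e : PiLp 2 (fun _ : ι => H)) j, (P e) j = ∑ k, C j k (e k) := by
    intro e j
    conv_lhs => rw [hsum e, map_sum]
    simp [C]
  have hPB : P (ampl B w') = ampl B w' := by
    ext j
    rw [hPe]
    have : ∀ k, C j k (ampl B w' k) = B (C j k (w' k)) := by
      intro k
      have := congrArg (fun S : H →L[ℂ] H => S (w' k)) (hB (C j k) (hC j k)).eq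
      simpa [ampl] using this.symm
    simp only [this]
    rw [← map_sum, ← hPe, hw]
    rfl
  have hmem : ampl B w' ∈ M := hPB ▸ hPmem _
  have hz : z' ∈ Mᗮ := by
    rw [Submodule.orthogonal_closure, Submodule.mem_orthogonal']
    rintro _ ⟨y, rfl⟩
    simpa [ampl, PiLp.inner_apply, z', w'] using h y
  have := (Submodule.mem_orthogonal' _ _).1 hz _ hmem
  simpa [ampl, PiLp.inner_apply, z', w'] using this

/-- Real-linear closure criterion in a complex Hilbert space. -/
theorem mem_closure_of_re_inner {E : Type*} [NormedAddCommGroup E] [InnerProductSpace ℂ E]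
    [CompleteSpace E] (S : AddSubgroup E) (hS : ∀ (r : ℝ), ∀ s ∈ S, (r : ℂ) • s ∈ S) (b : E)
    (h : ∀ z, (∀ s ∈ S, (inner ℂ z s).re = 0) → (inner ℂ z b).re = 0) :
    b ∈ closure (S : Set E) := by
  let _ : InnerProductSpace ℝ E := InnerProductSpace.rclikeToReal ℂ E
  let S' : Submodule ℝ E :=
    { S with smul_mem' := fun r s hs => hS r s hs }
  have hb : b ∈ S'ᗮᗮ := by
    rw [Submodule.mem_orthogonal]
    intro z hz
    refine h z fun s hs => ?_
    exact (Submodule.mem_orthogonal' _ _).1 hz s hs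
  rw [Submodule.orthogonal_orthogonal_eq_closure] at hb
  exact hb

/-- Strong approximation by self-adjoint elements. -/
theorem density_selfAdjoint {𝒜 : Type*} [NonUnitalCStarAlgebra 𝒜]
    {H : Type*} [NormedAddCommGroup H] [InnerProductSpace ℂ H] [CompleteSpace H]
    (ρ : 𝒜 →⋆ₙₐ[ℂ] (H →L[ℂ] H)) (hnd : ∀ v : H, (∀ x, ρ x v = 0) → v = 0)
    (B : H →L[ℂ] H) (hBs : IsSelfAdjoint B)
    (hB : ∀ C : H →L[ℂ] H, (∀ x, Commute (ρ x) C) → Commute B C)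
    {ι : Type*} [Fintype ι] (w : ι → H) (δ : ℝ) (hδ : 0 < δ) :
    ∃ y : 𝒜, IsSelfAdjoint y ∧ ∀ j, ‖ρ y (w j) - B (w j)‖ < δ := by
  classical
  let w' : PiLp 2 (fun _ : ι => H) := WithLp.toLp 2 w
  let S : AddSubgroup (PiLp 2 (fun _ : ι => H)) :=
    { carrier := {e | ∃ y : 𝒜, IsSelfAdjoint y ∧ ampl (ρ y) w' = e}
      add_mem' := by
        rintro _ _ ⟨x, hx, rfl⟩ ⟨y, hy, rfl⟩
        exact ⟨x + y, hx.add hy, by ext j; simp [ampl]⟩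
      zero_mem' := ⟨0, IsSelfAdjoint.zero _, by ext j; simp [ampl]⟩
      neg_mem' := by
        rintro _ ⟨x, hx, rfl⟩
        exact ⟨-x, hx.neg, by ext j; simp [ampl]⟩ }
  have hcl : ampl B w' ∈ closure (S : Set (PiLp 2 (fun _ : ι => H))) := by
    apply mem_closure_of_re_inner
    · rintro r _ ⟨y, hy, rfl⟩
      refine ⟨(r : ℂ) • y, ?_, by ext j; simp only [ampl, map_smul]; rfl⟩
      rw [isSelfAdjoint_iff, star_smul, hy.star_eq]
      simp
    · intro z hz
      have hsa : ∀ y : 𝒜, IsSelfAdjoint y →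
          ∑ j, inner ℂ (z j) (ρ y (w j)) + ∑ j, inner ℂ (w j) (ρ y (z j)) = 0 := by
        intro y hy
        have h1 := hz _ ⟨y, hy, rfl⟩
        have h2 : ∑ j, inner ℂ (w j) (ρ y (z j))
            = (starRingEnd ℂ) (∑ j, inner ℂ (z j) (ρ y (w j))) := by
          rw [map_sum]
          refine Finset.sum_congr rfl fun j _ => ?_
          rw [inner_conj_symm, ← ContinuousLinearMap.adjoint_inner_right,
            ← ContinuousLinearMap.star_eq_adjoint, ← map_star, hy.star_eq]
        rw [h2, Complex.add_conj]
        simp only [ampl, PiLp.inner_apply, w'] at h1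
        rw [h1]
        simp
      have hall : ∀ y : 𝒜,
          ∑ j, inner ℂ (z j) (ρ y (w j)) + ∑ j, inner ℂ (w j) (ρ y (z j)) = 0 := by
        intro y
        have e1 := hsa _ (realPart y).2
        have e2 := hsa _ (imaginaryPart y).2
        rw [← realPart_add_I_smul_imaginaryPart y]
        simp only [map_add, map_smul, add_apply,
          smul_apply, inner_add_right, inner_smul_right,
          Finset.sum_add_distrib, ← Finset.mul_sum]
        linear_combination e1 + Complex.I * e2
      have hD := density_functional ρ hnd B hB (ι := ι ⊕ ι) (Sum.elim (fun j => z j) w)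
        (Sum.elim w (fun j => z j)) (by
          intro y
          simpa [Fintype.sum_sum_type] using hall y)
      simp only [Fintype.sum_sum_type, Sum.elim_inl, Sum.elim_inr] at hD
      have h2 : ∑ j, inner ℂ (w j) (B (z j))
            = (starRingEnd ℂ) (∑ j, inner ℂ (z j) (B (w j))) := by
        rw [map_sum]
        refine Finset.sum_congr rfl fun j _ => ?_
        rw [inner_conj_symm, ← ContinuousLinearMap.adjoint_inner_right,
            ← ContinuousLinearMap.star_eq_adjoint, hBs.star_eq]
      rw [h2, Complex.add_conj] at hD
      simp only [ampl, PiLp.inner_apply, w']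
      have := congrArg Complex.re hD
      simpa using this
  obtain ⟨_, ⟨y, hy, rfl⟩, hd⟩ := Metric.mem_closure_iff.1 hcl δ hδ
  refine ⟨y, hy, fun j => lt_of_le_of_lt ?_ hd⟩
  rw [dist_comm, dist_eq_norm]
  exact PiLp.norm_apply_le (ampl (ρ y) w' - ampl B w') j
/-- The Cayley-type truncation of a self-adjoint element. -/
theorem exists_truncation {𝒜 : Type*} [NonUnitalCStarAlgebra 𝒜] (y : 𝒜) (hy : IsSelfAdjoint y) :
    ∃ x : 𝒜, ‖x‖ ≤ 1 ∧ ‖x * y‖ ≤ 2 ∧ x + x * y * y = (2 : ℂ) • y := by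
  have hpos : ∀ s : ℝ, 1 + s ^ 2 ≠ 0 := fun s => by positivity
  have hc : Continuous (fun s : ℝ => 2 * s / (1 + s ^ 2)) := by
    fun_prop (disch := exact hpos _)
  have hc2 : Continuous (fun s : ℝ => 2 * s / (1 + s ^ 2) * s) := by
    fun_prop (disch := exact hpos _)
  have hid : cfcₙ (fun s : ℝ => s) y = y := cfcₙ_id' ℝ y
  have hxy : cfcₙ (fun s : ℝ => 2 * s / (1 + s ^ 2)) y * y
      = cfcₙ (fun s : ℝ => 2 * s / (1 + s ^ 2) * s) y := by
    rw [cfcₙ_mul (fun s : ℝ => 2 * s / (1 + s ^ 2)) (fun s => s) y hc.continuousOn (by simp)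
      continuous_id.continuousOn (by simp), hid]
  have hxyy : cfcₙ (fun s : ℝ => 2 * s / (1 + s ^ 2) * s) y * y
      = cfcₙ (fun s : ℝ => 2 * s / (1 + s ^ 2) * s * s) y := by
    rw [cfcₙ_mul (fun s : ℝ => 2 * s / (1 + s ^ 2) * s) (fun s => s) y hc2.continuousOn (by simp)
      continuous_id.continuousOn (by simp), hid]
  refine ⟨cfcₙ (fun s : ℝ => 2 * s / (1 + s ^ 2)) y, ?_, ?_, ?_⟩
  · refine norm_cfcₙ_le fun s _ => ?_
    rw [Real.norm_eq_abs, abs_le]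
    have : 0 < 1 + s ^ 2 := by positivity
    constructor
    · rw [le_div_iff₀ this]; nlinarith [sq_nonneg (s + 1)]
    · rw [div_le_iff₀ this]; nlinarith [sq_nonneg (s - 1)]
  · rw [hxy]
    refine norm_cfcₙ_le fun s _ => ?_
    rw [Real.norm_eq_abs, abs_le]
    have : 0 < 1 + s ^ 2 := by positivity
    rw [div_mul_eq_mul_div]
    constructor
    · rw [le_div_iff₀ this]; nlinarith [sq_nonneg s]
    · rw [div_le_iff₀ this]; nlinarith [sq_nonneg s]
  · rw [hxy, hxyy, ← cfcₙ_add (fun s : ℝ => 2 * s / (1 + s ^ 2))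
      (fun s => 2 * s / (1 + s ^ 2) * s * s) y hc.continuousOn (by simp)
      (hc2.mul continuous_id).continuousOn (by simp)]
    have : (fun s : ℝ => 2 * s / (1 + s ^ 2) + 2 * s / (1 + s ^ 2) * s * s)
        = fun s => (2 : ℝ) • s := by
      funext s
      have := hpos s
      simp only [smul_eq_mul]
      field_simp
    rw [this, cfcₙ_smul (2 : ℝ) (fun s : ℝ => s) y, hid]
    rw [two_smul, two_smul]

/-- Kaplansky density, self-adjoint case. -/
theorem kaplansky_selfAdjoint {𝒜 : Type*} [NonUnitalCStarAlgebra 𝒜]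
    {H : Type*} [NormedAddCommGroup H] [InnerProductSpace ℂ H] [CompleteSpace H]
    (ρ : 𝒜 →⋆ₙₐ[ℂ] (H →L[ℂ] H)) (hnd : ∀ v : H, (∀ x, ρ x v = 0) → v = 0)
    (B : H →L[ℂ] H) (hBs : IsSelfAdjoint B) (hB1 : ‖B‖ ≤ 1)
    (hB : ∀ C : H →L[ℂ] H, (∀ x, Commute (ρ x) C) → Commute B C)
    {ι : Type*} [Fintype ι] (w : ι → H) (ε : ℝ) (hε : 0 < ε) :
    ∃ x : 𝒜, ‖x‖ ≤ 1 ∧ ∀ j, ‖ρ x (w j) - B (w j)‖ < ε := by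
  let q : ℝ → ℝ := fun s => 1 + √(1 - s ^ 2)
  have hq : ∀ s, 0 < q s := fun s => by
    have := Real.sqrt_nonneg (1 - s ^ 2)
    simp only [q]; linarith
  have hqc : Continuous q := by fun_prop
  have hgc : Continuous (fun s => s / q s) :=
    continuous_id.div hqc fun s => (hq s).ne'
  have hspec : ∀ s ∈ spectrum ℝ B, s ^ 2 ≤ 1 := by
    intro s hs
    have h1 : ‖s‖ ≤ ‖B‖ * ‖(1 : H →L[ℂ] H)‖ := spectrum.norm_le_norm_mul_of_mem hs
    have h2 : ‖(1 : H →L[ℂ] H)‖ ≤ 1 := ContinuousLinearMap.norm_id_le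
    have h3 : |s| ≤ 1 := by
      rw [← Real.norm_eq_abs]
      calc ‖s‖ ≤ ‖B‖ * ‖(1 : H →L[ℂ] H)‖ := h1
        _ ≤ 1 * 1 := by gcongr
        _ = 1 := by ring
    rw [← sq_abs]
    have := abs_nonneg s
    nlinarith
  have hqs : ∀ s, s ^ 2 ≤ 1 → q s ^ 2 + s ^ 2 = 2 * q s := by
    intro s hs
    have := Real.sq_sqrt (show 0 ≤ 1 - s ^ 2 by linarith)
    simp only [q]
    linear_combination this
  let B' : H →L[ℂ] H := cfc (fun s => s / q s) B
  let E : H →L[ℂ] H := cfc (fun s => q s / 2) B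
  have hB's : IsSelfAdjoint B' := cfc_predicate _ _
  have hB'c : ∀ C : H →L[ℂ] H, (∀ x, Commute (ρ x) C) → Commute B' C := by
    intro C hC
    exact (hB C hC).cfc_real _
  have hBE : (2 : ℂ) • (B' * E) = B := by
    have : B' * E = cfc (fun s : ℝ => (1 / 2 : ℝ) • s) B := by
      simp only [B', E]
      rw [← cfc_mul (fun s => s / q s) (fun s => q s / 2) B hgc.continuousOn
        (hqc.div_const 2).continuousOn]
      congr 1
      funext s
      have := (hq s).ne'
      simp only [smul_eq_mul]
      field_simp
    rw [this, cfc_smul (1 / 2 : ℝ) (fun s : ℝ => s) B, cfc_id' ℝ B, two_smul, ← add_smul]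
    norm_num
  have hE1 : E + B' * (B' * E) = 1 := by
    simp only [B', E]
    rw [← cfc_mul (fun s => s / q s) (fun s => q s / 2) B hgc.continuousOn
        (hqc.div_const 2).continuousOn,
      ← cfc_mul (fun s => s / q s) (fun s => s / q s * (q s / 2)) B hgc.continuousOn
        (hgc.mul (hqc.div_const 2)).continuousOn,
      ← cfc_add B (fun s => q s / 2) (fun s => s / q s * (s / q s * (q s / 2)))
        (hqc.div_const 2).continuousOn (hgc.mul (hgc.mul (hqc.div_const 2))).continuousOn]
    rw [← cfc_const_one ℝ B]
    refine cfc_congr fun s hs => ?_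
    have h1 := (hq s).ne'
    have h2 := hqs s (hspec s hs)
    field_simp
    linear_combination h2
  obtain ⟨y, hy, hyw⟩ := density_selfAdjoint ρ hnd B' hB's hB'c (ι := ι ⊕ ι)
    (Sum.elim (fun j => E (w j)) (fun j => B' (E (w j)))) (ε / 5) (by positivity)
  obtain ⟨x, hx1, hxy, hxe⟩ := exists_truncation y hy
  refine ⟨x, hx1, fun j => ?_⟩
  have d1 := hyw (Sum.inl j)
  have d2 := hyw (Sum.inr j)
  simp only [Sum.elim_inl, Sum.elim_inr] at d1 d2
  set p := E (w j)
  have ew : w j = p + B' (B' p) := by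
    have := congrArg (fun S : H →L[ℂ] H => S (w j)) hE1
    simpa [p] using this.symm
  have eB : B (w j) = (2 : ℂ) • B' p := by
    have := congrArg (fun S : H →L[ℂ] H => S (w j)) hBE
    simpa [p] using this.symm
  have ex : ρ x p + ρ x (ρ y (ρ y p)) = (2 : ℂ) • ρ y p := by
    have := congrArg (fun a : 𝒜 => ρ a p) hxe
    simpa only [map_add, map_mul, map_smul, add_apply, mul_apply_eq_comp, smul_apply] using this
  have key : ρ x (w j) - B (w j) = (2 : ℂ) • (ρ y p - B' p) - ρ (x * y) (ρ y p - B' p)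
      - ρ x (ρ y (B' p) - B' (B' p)) := by
    rw [eB]
    conv_lhs => rw [ew]
    simp only [map_add, map_sub, map_mul, mul_apply_eq_comp, smul_sub]
    rw [← ex]
    abel
  rw [key]
  have n1 : ‖ρ (x * y) (ρ y p - B' p)‖ ≤ 2 * ‖ρ y p - B' p‖ :=
    (ContinuousLinearMap.le_opNorm _ _).trans
      (by gcongr; exact (NonUnitalStarAlgHom.norm_apply_le ρ _).trans hxy)
  have n2 : ‖ρ x (ρ y (B' p) - B' (B' p))‖ ≤ 1 * ‖ρ y (B' p) - B' (B' p)‖ :=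
    (ContinuousLinearMap.le_opNorm _ _).trans
      (by gcongr; exact (NonUnitalStarAlgHom.norm_apply_le ρ _).trans hx1)
  have n3 : ‖(2 : ℂ) • (ρ y p - B' p)‖ = 2 * ‖ρ y p - B' p‖ := by
    rw [norm_smul]; simp
  calc _ ≤ ‖(2 : ℂ) • (ρ y p - B' p)‖ + ‖ρ (x * y) (ρ y p - B' p)‖
        + ‖ρ x (ρ y (B' p) - B' (B' p))‖ := by
        refine (norm_sub_le _ _).trans ?_
        gcongr
        exact norm_sub_le _ _
    _ < ε := by rw [n3]; linarith

/-- Kaplansky-type density with norm bound `2`. -/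
theorem kaplansky_two {𝒜 : Type*} [NonUnitalCStarAlgebra 𝒜]
    {H : Type*} [NormedAddCommGroup H] [InnerProductSpace ℂ H] [CompleteSpace H]
    (ρ : 𝒜 →⋆ₙₐ[ℂ] (H →L[ℂ] H)) (hnd : ∀ v : H, (∀ x, ρ x v = 0) → v = 0)
    (B : H →L[ℂ] H) (hB1 : ‖B‖ ≤ 1)
    (hB : ∀ C : H →L[ℂ] H, (∀ x, Commute (ρ x) C) → Commute B C)
    {ι : Type*} [Fintype ι] (w : ι → H) (ε : ℝ) (hε : 0 < ε) :
    ∃ x : 𝒜, ‖x‖ ≤ 2 ∧ ∀ j, ‖ρ x (w j) - B (w j)‖ < ε := by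
  have hBstar : ∀ C : H →L[ℂ] H, (∀ x, Commute (ρ x) C) → Commute (star B) C := by
    intro C hC
    have : Commute B (star C) := hB _ fun x => by
      have := (hC (star x)).star_star
      rwa [map_star, star_star] at this
    simpa using this.star_star
  have hre : ∀ C : H →L[ℂ] H, (∀ x, Commute (ρ x) C) →
      Commute ((realPart B : H →L[ℂ] H)) C := by
    intro C hC
    rw [realPart_apply_coe]
    exact ((hB C hC).add_left (hBstar C hC)).smul_left _
  have him : ∀ C : H →L[ℂ] H, (∀ x, Commute (ρ x) C) →
      Commute ((imaginaryPart B : H →L[ℂ] H)) C := by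
    intro C hC
    rw [imaginaryPart_apply_coe]
    exact (((hB C hC).sub_left (hBstar C hC)).smul_left _).smul_left _
  obtain ⟨x1, h1, h1'⟩ := kaplansky_selfAdjoint ρ hnd (realPart B : H →L[ℂ] H) (realPart B).2
    ((realPart.norm_le B).trans hB1) hre w (ε / 2) (by positivity)
  obtain ⟨x2, h2, h2'⟩ := kaplansky_selfAdjoint ρ hnd (imaginaryPart B : H →L[ℂ] H)
    (imaginaryPart B).2 ((imaginaryPart.norm_le B).trans hB1) him w (ε / 2) (by positivity)
  refine ⟨x1 + Complex.I • x2, ?_, fun j => ?_⟩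
  · refine (norm_add_le _ _).trans ?_
    rw [norm_smul, Complex.norm_I]; linarith
  · have e : ρ (x1 + Complex.I • x2) (w j) - B (w j)
        = (ρ x1 (w j) - (realPart B : H →L[ℂ] H) (w j))
          + Complex.I • (ρ x2 (w j) - (imaginaryPart B : H →L[ℂ] H) (w j)) := by
      conv_lhs => rw [← realPart_add_I_smul_imaginaryPart B]
      simp only [map_add, map_smul, add_apply, smul_apply, smul_sub]
      abel
    rw [e]
    refine (norm_add_le _ _).trans_lt ?_
    rw [norm_smul, Complex.norm_I]
    linarith [h1' j, h2' j]
/-- Schur's lemma: self-adjoint elements of the commutant are scalars. -/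
theorem schur_selfAdjoint {𝒜 : Type*} [NonUnitalCStarAlgebra 𝒜]
    {H : Type*} [NormedAddCommGroup H] [InnerProductSpace ℂ H] [CompleteSpace H]
    (π : 𝒜 →⋆ₙₐ[ℂ] (H →L[ℂ] H))
    (hirr : ∀ V : Submodule ℂ H, IsClosed (V : Set H) →
        (∀ x : 𝒜, ∀ v ∈ V, π x v ∈ V) → V = ⊥ ∨ V = ⊤)
    (S : H →L[ℂ] H) (hS : IsSelfAdjoint S) (hc : ∀ x, Commute (π x) S) :
    ∃ c : ℝ, S = (c : ℂ) • (1 : H →L[ℂ] H) := by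
  by_cases hsub : (spectrum ℝ S).Subsingleton
  · obtain h | ⟨c, h⟩ := hsub.eq_empty_or_singleton
    · refine ⟨0, ?_⟩
      have := CFC.eq_algebraMap_of_spectrum_subset_singleton (R := ℝ) S 0 (by simp [h])
      simpa using this
    · refine ⟨c, ?_⟩
      have := CFC.eq_algebraMap_of_spectrum_subset_singleton (R := ℝ) S c (by simp [h])
      rw [this, Algebra.algebraMap_eq_smul_one]
      ext v
      simp
  · exfalso
    rw [Set.not_subsingleton_iff] at hsub
    obtain ⟨a, ha, b, hb, hab⟩ := hsub.exists_lt
    let m := (a + b) / 2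
    let f : ℝ → ℝ := fun s => max (m - s) 0
    let g : ℝ → ℝ := fun s => max (s - m) 0
    have hf : Continuous f := by fun_prop
    have hg : Continuous g := by fun_prop
    have hfg : cfc f S * cfc g S = 0 := by
      rw [← cfc_mul f g S hf.continuousOn hg.continuousOn]
      have : (fun x => f x * g x) = fun _ => (0 : ℝ) := by
        funext s
        rcases le_total s m with h | h
        · have : g s = 0 := max_eq_right (by linarith)
          rw [this, mul_zero]
        · have : f s = 0 := max_eq_right (by linarith)
          rw [this, zero_mul]
      rw [this]
      exact cfc_const_zero ℝ S
    have hne : ∀ (h : ℝ → ℝ), Continuous h → ∀ s ∈ spectrum ℝ S, h s ≠ 0 → cfc h S ≠ 0 := by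
      intro h hh s hs hs0 h0
      have h1 : h s ∈ spectrum ℝ (cfc h S) := by
        rw [cfc_map_spectrum h S hS hh.continuousOn]
        exact ⟨s, hs, rfl⟩
      rw [h0] at h1
      have h2 := spectrum.norm_le_norm_mul_of_mem h1
      rw [norm_zero, zero_mul] at h2
      exact hs0 (norm_le_zero_iff.1 h2)
    have hf0 : cfc f S ≠ 0 := hne f hf a ha (by
      have : 0 < m - a := by simp only [m]; linarith
      exact (lt_max_of_lt_left this).ne')
    have hg0 : cfc g S ≠ 0 := hne g hg b hb (by
      have : 0 < b - m := by simp only [m]; linarith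
      exact (lt_max_of_lt_left this).ne')
    have hcf : ∀ x, Commute (cfc f S) (π x) := fun x => (hc x).symm.cfc_real f
    let V : Submodule ℂ H := LinearMap.ker ((cfc f S : H →L[ℂ] H) : H →ₗ[ℂ] H)
    have hV : ∀ v, v ∈ V ↔ (cfc f S : H →L[ℂ] H) v = 0 := fun v => Iff.rfl
    rcases hirr V (ContinuousLinearMap.isClosed_ker _) (by
      intro x v hv
      rw [hV] at hv ⊢
      have := congrArg (fun T : H →L[ℂ] H => T v) (hcf x).eq
      simp only [mul_apply_eq_comp] at this
      rw [this, hv, map_zero]) with h | h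
    · apply hg0
      ext v
      have h3 : (cfc g S : H →L[ℂ] H) v ∈ V := by
        rw [hV]
        have := congrArg (fun T : H →L[ℂ] H => T v) hfg
        simpa using this
      rw [h] at h3
      simpa using h3
    · apply hf0
      ext v
      have h3 : v ∈ V := by rw [h]; trivial
      simpa using (hV v).1 h3

/-- Schur's lemma: the commutant consists of scalars. -/
theorem schur_scalar {𝒜 : Type*} [NonUnitalCStarAlgebra 𝒜]
    {H : Type*} [NormedAddCommGroup H] [InnerProductSpace ℂ H] [CompleteSpace H]
    (π : 𝒜 →⋆ₙₐ[ℂ] (H →L[ℂ] H))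
    (hirr : ∀ V : Submodule ℂ H, IsClosed (V : Set H) →
        (∀ x : 𝒜, ∀ v ∈ V, π x v ∈ V) → V = ⊥ ∨ V = ⊤)
    (S : H →L[ℂ] H) (hc : ∀ x, Commute (π x) S) :
    ∃ c : ℂ, S = c • (1 : H →L[ℂ] H) := by
  have hstar : ∀ x, Commute (π x) (star S) := by
    intro x
    have := (hc (star x)).star_star
    rwa [map_star, star_star] at this
  obtain ⟨a, ha⟩ := schur_selfAdjoint π hirr (realPart S : H →L[ℂ] H) (realPart S).2 (by
    intro x
    rw [realPart_apply_coe]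
    exact ((hc x).add_right (hstar x)).smul_right _)
  obtain ⟨b, hb⟩ := schur_selfAdjoint π hirr (imaginaryPart S : H →L[ℂ] H) (imaginaryPart S).2 (by
    intro x
    rw [imaginaryPart_apply_coe]
    exact (((hc x).sub_right (hstar x)).smul_right _).smul_right _)
  refine ⟨a + Complex.I * b, ?_⟩
  rw [← realPart_add_I_smul_imaginaryPart S, ha, hb, add_smul, mul_smul]

/-- Schur's lemma: intertwiners between inequivalent irreducible representations vanish. -/
theorem schur_intertwiner {𝒜 : Type*} [NonUnitalCStarAlgebra 𝒜]
    {H K : Type*} [NormedAddCommGroup H] [InnerProductSpace ℂ H] [CompleteSpace H]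
    [NormedAddCommGroup K] [InnerProductSpace ℂ K] [CompleteSpace K]
    (π : 𝒜 →⋆ₙₐ[ℂ] (H →L[ℂ] H)) (σ : 𝒜 →⋆ₙₐ[ℂ] (K →L[ℂ] K))
    (hπ : ∀ V : Submodule ℂ H, IsClosed (V : Set H) →
        (∀ x : 𝒜, ∀ v ∈ V, π x v ∈ V) → V = ⊥ ∨ V = ⊤)
    (hσ : ∀ V : Submodule ℂ K, IsClosed (V : Set K) →
        (∀ x : 𝒜, ∀ v ∈ V, σ x v ∈ V) → V = ⊥ ∨ V = ⊤)
    (hne : ¬ ∃ U : H ≃ₗᵢ[ℂ] K, ∀ (x : 𝒜) (v : H), U (π x v) = σ x (U v))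
    (C : H →L[ℂ] K) (hC : ∀ x v, C (π x v) = σ x (C v)) : C = 0 := by
  by_contra hC0
  have hCa : ∀ x v, (ContinuousLinearMap.adjoint C) (σ x v)
      = π x ((ContinuousLinearMap.adjoint C) v) := by
    intro x v
    refine ext_inner_right ℂ fun u => ?_
    rw [ContinuousLinearMap.adjoint_inner_left]
    have e1 : ∀ (w : K), inner ℂ (σ x v) w = inner ℂ v (σ (star x) w) := by
      intro w
      rw [map_star, ContinuousLinearMap.star_eq_adjoint, ContinuousLinearMap.adjoint_inner_right]
    have e2 : ∀ (v w : H), inner ℂ (π x v) w = inner ℂ v (π (star x) w) := by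
      intro v w
      rw [map_star, ContinuousLinearMap.star_eq_adjoint, ContinuousLinearMap.adjoint_inner_right]
    rw [e1, e2, ContinuousLinearMap.adjoint_inner_left, hC]
  obtain ⟨c, hc⟩ := schur_selfAdjoint π hπ ((ContinuousLinearMap.adjoint C).comp C)
    (by
      rw [isSelfAdjoint_iff, ContinuousLinearMap.star_eq_adjoint,
        ContinuousLinearMap.adjoint_comp, ContinuousLinearMap.adjoint_adjoint])
    (by
      intro x
      ext v
      simp only [mul_apply_eq_comp, ContinuousLinearMap.comp_apply]
      rw [hC, hCa])
  have hnorm : ∀ v, ‖C v‖ ^ 2 = c * ‖v‖ ^ 2 := by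
    intro v
    have h1 : inner ℂ v (((ContinuousLinearMap.adjoint C).comp C) v) = inner ℂ (C v) (C v) := by
      rw [ContinuousLinearMap.comp_apply, ContinuousLinearMap.adjoint_inner_right]
    rw [hc] at h1
    simp only [smul_apply, one_apply_eq_self, inner_smul_right] at h1
    have h2 := congrArg Complex.re h1
    rw [Complex.re_ofReal_mul] at h2
    have h3 : (inner ℂ v v).re = ‖v‖ ^ 2 := inner_self_eq_norm_sq (𝕜 := ℂ) v
    have h4 : (inner ℂ (C v) (C v)).re = ‖C v‖ ^ 2 := inner_self_eq_norm_sq (𝕜 := ℂ) (C v)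
    rw [← h3, ← h4, h2]
  have hcpos : 0 < c := by
    obtain ⟨v, hv⟩ : ∃ v, C v ≠ 0 := by
      by_contra h
      push Not at h
      exact hC0 (by ext v; simpa using h v)
    have h1 := hnorm v
    have h2 : 0 < ‖C v‖ ^ 2 := by positivity
    by_contra h3
    have : c * ‖v‖ ^ 2 ≤ 0 := mul_nonpos_of_nonpos_of_nonneg (not_lt.1 h3) (by positivity)
    linarith
  have hs : 0 < √c := Real.sqrt_pos.2 hcpos
  let D : H →ₗ[ℂ] K := ((((√c)⁻¹ : ℝ) : ℂ) • C : H →L[ℂ] K)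
  have hDapp : ∀ v, D v = (((√c)⁻¹ : ℝ) : ℂ) • C v := fun v => rfl
  have hD : ∀ v, ‖D v‖ = ‖v‖ := by
    intro v
    have h1 : ‖C v‖ = √c * ‖v‖ := by
      rw [← Real.sqrt_sq (norm_nonneg (C v)), hnorm, Real.sqrt_mul hcpos.le,
        Real.sqrt_sq (norm_nonneg v)]
    rw [hDapp, norm_smul, h1, Complex.norm_real, Real.norm_eq_abs, abs_of_pos (inv_pos.2 hs)]
    field_simp
  let L : H →ₗᵢ[ℂ] K := ⟨D, hD⟩
  have hLx : ∀ x v, L (π x v) = σ x (L v) := by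
    intro x v
    change D (π x v) = σ x (D v)
    rw [hDapp, hDapp, hC, map_smul]
  have hclosed : IsClosed ((LinearMap.range D : Submodule ℂ K) : Set K) := by
    have := L.isometry.isClosedEmbedding.isClosed_range
    exact this
  have hsurj : Function.Surjective L := by
    rcases hσ (LinearMap.range D) hclosed (by
      rintro x _ ⟨v, rfl⟩
      exact ⟨π x v, hLx x v⟩) with h | h
    · exfalso
      apply hC0
      ext v
      have h1 : D v ∈ LinearMap.range D := ⟨v, rfl⟩
      rw [h, Submodule.mem_bot] at h1
      have h2 := hD v
      rw [h1, norm_zero] at h2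
      have : v = 0 := norm_eq_zero.1 h2.symm
      rw [this]
      simp
    · intro k
      have : k ∈ LinearMap.range D := by rw [h]; trivial
      exact this
  exact hne ⟨LinearIsometryEquiv.ofSurjective L hsurj, fun x v => hLx x v⟩

section approx
variable {X Y : Type*} [NormedAddCommGroup X] [NormedSpace ℂ X]
    [NormedAddCommGroup Y] [NormedSpace ℂ Y]

lemma approxNum_nonneg (T : X →L[ℂ] Y) (n : ℕ) : 0 ≤ approxNum T n := by
  apply Real.sInf_nonneg
  rintro c ⟨F, -, rfl⟩
  exact norm_nonneg _

lemma approxNum_le (T F : X →L[ℂ] Y) (n : ℕ)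
    (hF : LinearMap.rank (F : X →ₗ[ℂ] Y) < (n : Cardinal)) : approxNum T n ≤ ‖T - F‖ := by
  apply csInf_le
  · refine ⟨0, ?_⟩
    rintro c ⟨F, -, rfl⟩
    exact norm_nonneg _
  · exact ⟨F, hF, rfl⟩

lemma approxNum_antitone (T : X →L[ℂ] Y) : Antitone (fun n => approxNum T (n + 1)) := by
  intro m n hmn
  apply csInf_le_csInf
  · refine ⟨0, ?_⟩
    rintro c ⟨F, -, rfl⟩
    exact norm_nonneg _
  · refine ⟨‖T - 0‖, 0, ?_, rfl⟩
    have : ((0 : X →L[ℂ] Y) : X →ₗ[ℂ] Y) = 0 := rfl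
    rw [this, LinearMap.rank_zero]
    exact_mod_cast Nat.succ_pos m
  · rintro c ⟨F, hF, rfl⟩
    exact ⟨F, lt_of_lt_of_le hF (by exact_mod_cast Nat.succ_le_succ hmn), rfl⟩

lemma kolNum_nonneg (T : X →L[ℂ] Y) (n : ℕ) : 0 ≤ kolNum T n := by
  apply Real.sInf_nonneg
  rintro c ⟨F, -, rfl⟩
  exact Real.iSup_nonneg fun x => Real.iInf_nonneg fun y => norm_nonneg _

lemma kolNum_set_nonempty (T : X →L[ℂ] Y) (n : ℕ) :
    {c | ∃ V : Submodule ℂ Y, Module.rank ℂ V < ((n + 1 : ℕ) : Cardinal) ∧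
    c = ⨆ x : {x : X // ‖x‖ ≤ 1}, ⨅ y : V, ‖T x.1 - (y : Y)‖}.Nonempty := by
  refine ⟨_, ⊥, ?_, rfl⟩
  rw [rank_bot]
  exact_mod_cast Nat.succ_pos n

lemma kolNum_antitone (T : X →L[ℂ] Y) : Antitone (fun n => kolNum T (n + 1)) := by
  intro m n hmn
  apply csInf_le_csInf
  · refine ⟨0, ?_⟩
    rintro c ⟨F, -, rfl⟩
    exact Real.iSup_nonneg fun x => Real.iInf_nonneg fun y => norm_nonneg _
  · exact kolNum_set_nonempty T m
  · rintro c ⟨F, hF, rfl⟩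
    exact ⟨F, lt_of_lt_of_le hF (by exact_mod_cast Nat.succ_le_succ hmn), rfl⟩

lemma isCompactOperator_of_rank_lt (F : X →L[ℂ] Y) (n : ℕ)
    (hF : LinearMap.rank (F : X →ₗ[ℂ] Y) < (n : Cardinal)) : IsCompactOperator F := by
  have hfin : FiniteDimensional ℂ (LinearMap.range (F : X →ₗ[ℂ] Y)) := by
    rw [FiniteDimensional, ← Module.rank_lt_aleph0_iff]
    exact lt_trans hF (Cardinal.natCast_lt_aleph0)
  have hp : ProperSpace (LinearMap.range (F : X →ₗ[ℂ] Y)) := FiniteDimensional.proper ℂ _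
  let G : X →L[ℂ] LinearMap.range (F : X →ₗ[ℂ] Y) :=
    F.codRestrict _ (fun x => LinearMap.mem_range_self (F : X →ₗ[ℂ] Y) x)
  have hG : IsCompactOperator (LinearMap.range (F : X →ₗ[ℂ] Y)).subtypeL :=
    isCompactOperator_of_locallyCompactSpace_rng _
  exact hG.comp_clm G

lemma isCompactOperator_of_approxNum [CompleteSpace Y] (T : X →L[ℂ] Y)
    (h : Filter.Tendsto (fun n => approxNum T (n + 1)) Filter.atTop (nhds 0)) :
    IsCompactOperator T := by
  have hcl : IsClosed {f : X →L[ℂ] Y | IsCompactOperator f} :=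
    isClosed_setOfPred_isCompactOperator
  have : T ∈ closure {f : X →L[ℂ] Y | IsCompactOperator f} := by
    rw [Metric.mem_closure_iff]
    intro ε hε
    obtain ⟨n, hn⟩ := (h.eventually (gt_mem_nhds hε)).exists
    have hne : {c | ∃ F : X →L[ℂ] Y, LinearMap.rank (F : X →ₗ[ℂ] Y) < ((n + 1 : ℕ) : Cardinal)
      ∧ c = ‖T - F‖}.Nonempty := by
      refine ⟨‖T - 0‖, 0, ?_, rfl⟩
      have : ((0 : X →L[ℂ] Y) : X →ₗ[ℂ] Y) = 0 := rfl
      rw [this, LinearMap.rank_zero]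
      exact_mod_cast Nat.succ_pos n
    obtain ⟨c, ⟨F, hF, rfl⟩, hc⟩ := exists_lt_of_csInf_lt hne hn
    exact ⟨F, isCompactOperator_of_rank_lt F _ hF, by rwa [dist_eq_norm]⟩
  rwa [hcl.closure_eq] at this

end approx

section greedy
variable {I : Type*} {Hi : I → Type*} [∀ i, NormedAddCommGroup (Hi i)]
    [∀ i, InnerProductSpace ℂ (Hi i)] [∀ i, CompleteSpace (Hi i)]

lemma block_single [DecidableEq I] (T : lp Hi 2 →L[ℂ] lp Hi 2) (Ti : ∀ i, Hi i → Hi i)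
    (hT : ∀ v i, (T v : ∀ i, Hi i) i = Ti i (v i)) (v : lp Hi 2) (i : I) :
    T (lp.single 2 i (v i)) = lp.single 2 i ((T v : ∀ i, Hi i) i) := by
  have h0 : ∀ j, Ti j 0 = 0 := by
    intro j
    have := hT 0 j
    simpa using this.symm
  ext j
  rw [hT]
  by_cases hj : j = i
  · subst hj
    rw [lp.single_apply_self, lp.single_apply_self, hT]
  · rw [lp.single_apply_ne _ _ _ hj, lp.single_apply_ne _ _ _ hj, h0]

lemma norm_sq_lp (v : lp Hi 2) : HasSum (fun i => ‖(v : ∀ i, Hi i) i‖ ^ 2) (‖v‖ ^ 2) := by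
  have := lp.hasSum_norm (p := 2) (by norm_num) v
  simpa using this

lemma greedy_step [DecidableEq I] (T : lp Hi 2 →L[ℂ] lp Hi 2) (Ti : ∀ i, Hi i → Hi i)
    (hT : ∀ v i, (T v : ∀ i, Hi i) i = Ti i (v i)) (t : ℝ) (ht : 0 ≤ t) (k : ℕ)
    (hta : t < approxNum T (2 * k + 1)) (s : Finset (lp Hi 2)) (hs : s.card ≤ k)
    (hhom : ∀ u ∈ s, ∃ i a, u = lp.single 2 i a) :
    ∃ u : lp Hi 2, (∃ i a, u = lp.single 2 i a) ∧ ‖u‖ = 1 ∧ t < ‖T u‖ ∧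
      ∀ g ∈ s, inner ℂ g u = 0 ∧ inner ℂ (T g) (T u) = 0 := by
  by_contra hcon
  classical
  have hcon' : ∀ i (a : Hi i), (∀ g ∈ s, inner ℂ g (lp.single 2 i a : lp Hi 2) = 0 ∧
      inner ℂ (T g) (T (lp.single 2 i a)) = 0) →
      ‖T (lp.single 2 i a)‖ ≤ t * ‖(lp.single 2 i a : lp Hi 2)‖ := by
    intro i a h
    by_contra hlt
    push Not at hlt
    apply hcon
    set w : lp Hi 2 := lp.single 2 i a with hw
    have hw0 : w ≠ 0 := by
      intro h0
      rw [h0] at hlt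
      simp at hlt
    have hwn : 0 < ‖w‖ := norm_pos_iff.mpr hw0
    refine ⟨((‖w‖⁻¹ : ℝ) : ℂ) • w, ⟨i, ((‖w‖⁻¹ : ℝ) : ℂ) • a, ?_⟩, ?_, ?_, ?_⟩
    · rw [hw, lp.single_smul]
    · rw [norm_smul]
      simp [hwn.ne']
    · rw [map_smul, norm_smul]
      simp only [Complex.norm_real, norm_inv, norm_norm]
      rw [inv_mul_eq_div, lt_div_iff₀ hwn]
      exact hlt
    · intro g hg
      rw [map_smul, inner_smul_right, inner_smul_right, (h g hg).1, (h g hg).2]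
      simp
  let A := ContinuousLinearMap.adjoint T
  let G : Finset (lp Hi 2) := s ∪ s.image (fun u => A (T u))
  let L : Submodule ℂ (lp Hi 2) := Submodule.span ℂ (G : Set (lp Hi 2))
  have hfd : FiniteDimensional ℂ L := FiniteDimensional.span_finset ℂ G
  have hcard : Module.finrank ℂ L ≤ 2 * k := by
    refine (finrank_span_finset_le_card G).trans ?_
    refine (Finset.card_union_le _ _).trans ?_
    have := Finset.card_image_le (s := s) (f := fun u => A (T u))
    omega
  have hLperp : ∀ v ∈ Lᗮ, ‖T v‖ ≤ t * ‖v‖ := by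
    intro v hv
    have hv1 : ∀ g ∈ s, inner ℂ g v = 0 := fun g hg =>
      hv g (Submodule.subset_span (by simp [G, hg]))
    have hv2 : ∀ g ∈ s, inner ℂ (T g) (T v) = 0 := by
      intro g hg
      rw [← ContinuousLinearMap.adjoint_inner_left]
      refine hv _ (Submodule.subset_span ?_)
      simp only [G, Finset.coe_union, Finset.coe_image]
      exact Or.inr ⟨g, hg, rfl⟩
    have key : ∀ i, ‖(T v : ∀ i, Hi i) i‖ ≤ t * ‖(v : ∀ i, Hi i) i‖ := by
      intro i
      have := hcon' i (v i) ?_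
      · rw [block_single T Ti hT, lp.norm_single (by norm_num), lp.norm_single (by norm_num)] at this
        exact this
      · intro g hg
        have h1 := hv1 g hg
        have h2 := hv2 g hg
        obtain ⟨j, b, rfl⟩ := hhom g hg
        rw [block_single T Ti hT]
        have hTb : T (lp.single 2 j b) = lp.single 2 j (Ti j b) := by
          have := block_single T Ti hT (lp.single 2 j b) j
          rw [hT, lp.single_apply_self] at this
          exact this
        rw [hTb] at h2 ⊢
        rw [lp.inner_single_left] at h1 h2 ⊢
        rw [lp.inner_single_left]
        by_cases hij : j = i
        · subst hij
          rw [lp.single_apply_self, lp.single_apply_self]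
          exact ⟨h1, h2⟩
        · rw [lp.single_apply_ne _ _ _ hij, lp.single_apply_ne _ _ _ hij]
          simp
    have h1 := norm_sq_lp (T v)
    have h2 := (norm_sq_lp v).mul_left (t ^ 2)
    have h3 : ‖T v‖ ^ 2 ≤ t ^ 2 * ‖v‖ ^ 2 := by
      refine hasSum_le ?_ h1 h2
      intro i
      rw [← mul_pow]
      exact pow_le_pow_left₀ (norm_nonneg _) (key i) 2
    rw [← mul_pow] at h3
    exact le_of_sq_le_sq h3 (by positivity)
  let F : lp Hi 2 →L[ℂ] lp Hi 2 := T ∘L L.starProjection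
  have hrank : LinearMap.rank (F : lp Hi 2 →ₗ[ℂ] lp Hi 2) < ((2 * k + 1 : ℕ) : Cardinal) := by
    have h1 : LinearMap.rank (F : lp Hi 2 →ₗ[ℂ] lp Hi 2) ≤
        LinearMap.rank (L.starProjection : lp Hi 2 →ₗ[ℂ] lp Hi 2) :=
      LinearMap.rank_comp_le_right _ _
    have h2 : LinearMap.rank (L.starProjection : lp Hi 2 →ₗ[ℂ] lp Hi 2) ≤ Module.rank ℂ L := by
      apply Submodule.rank_mono
      rintro _ ⟨x, rfl⟩
      exact L.starProjection_apply_mem x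
    refine lt_of_le_of_lt (h1.trans h2) ?_
    rw [← Module.finrank_eq_rank]
    exact_mod_cast Nat.lt_succ_of_le hcard
  have hn : ‖T - F‖ ≤ t := by
    refine ContinuousLinearMap.opNorm_le_bound _ ht ?_
    intro v
    have : (T - F) v = T (v - L.starProjection v) := by
      simp [F]
    rw [this]
    refine (hLperp _ (L.sub_starProjection_mem_orthogonal v)).trans ?_
    gcongr
    have := L.norm_sq_eq_add_norm_sq_starProjection v
    rw [L.starProjection_orthogonal_val] at this
    exact le_of_sq_le_sq (by nlinarith [sq_nonneg ‖L.starProjection v‖]) (norm_nonneg _)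
  exact absurd (approxNum_le T F _ hrank) (not_le.mpr (lt_of_le_of_lt hn hta))

lemma greedy [DecidableEq I] (T : lp Hi 2 →L[ℂ] lp Hi 2) (Ti : ∀ i, Hi i → Hi i)
    (hT : ∀ v i, (T v : ∀ i, Hi i) i = Ti i (v i)) (t : ℝ) (ht : 0 ≤ t) (m : ℕ)
    (hta : t < approxNum T (2 * m + 1)) : ∀ k ≤ m + 1, ∃ s : Finset (lp Hi 2), s.card = k ∧
      (∀ u ∈ s, (∃ i a, u = lp.single 2 i a) ∧ ‖u‖ = 1 ∧ t < ‖T u‖) ∧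
      (∀ u ∈ s, ∀ v ∈ s, u ≠ v → inner ℂ u v = 0 ∧ inner ℂ (T u) (T v) = 0) := by
  classical
  intro k
  induction k with
  | zero => intro _; exact ⟨∅, by simp⟩
  | succ k ih =>
    intro hk
    obtain ⟨s, hsc, hs1, hs2⟩ := ih (by omega)
    obtain ⟨u, hu1, hu2, hu3, hu4⟩ := greedy_step T Ti hT t ht m hta s (by omega)
      (fun u hu => (hs1 u hu).1)
    have hus : u ∉ s := by
      intro h
      have := (hu4 u h).1
      rw [inner_self_eq_zero] at this
      rw [this] at hu2
      simp at hu2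
    refine ⟨insert u s, by rw [Finset.card_insert_of_notMem hus, hsc], ?_, ?_⟩
    · intro v hv
      rcases Finset.mem_insert.mp hv with rfl | hv
      · exact ⟨hu1, hu2, hu3⟩
      · exact hs1 v hv
    · intro v hv w hw hvw
      rcases Finset.mem_insert.mp hv with rfl | hv2
      · rcases Finset.mem_insert.mp hw with rfl | hw2
        · exact absurd rfl hvw
        · have := hu4 w hw2
          exact ⟨inner_eq_zero_symm.mp this.1, inner_eq_zero_symm.mp this.2⟩
      · rcases Finset.mem_insert.mp hw with rfl | hw2
        · exact hu4 v hv2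
        · exact hs2 v hv2 w hw2 hvw

end greedy

section kol
variable {𝒜 : Type*} [NonUnitalNormedRing 𝒜] [StarRing 𝒜]
    [NormedSpace ℂ 𝒜] [IsScalarTower ℂ 𝒜 𝒜] [SMulCommClass ℂ 𝒜 𝒜]
variable {H : Type*} [NormedAddCommGroup H] [InnerProductSpace ℂ H] [CompleteSpace H]

lemma exists_functional {ι : Type*} [Fintype ι] [DecidableEq ι] (m : ℕ)
    (hι : Fintype.card ι = m + 1) (Ψ : 𝒜 →ₗ[ℂ] (ι → ℂ)) (V : Submodule ℂ 𝒜)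
    (hV : Module.rank ℂ V < ((m + 1 : ℕ) : Cardinal)) :
    ∃ φ : ι → ℂ, 0 < ∑ j, ‖φ j‖ ∧ ∀ y ∈ V, ∑ j, φ j * Ψ y j = 0 := by
  have hlt : V.map Ψ < ⊤ := by
    rw [lt_top_iff_ne_top]
    intro htop
    have h1 : Module.rank ℂ (ι → ℂ) = ((m + 1 : ℕ) : Cardinal) := by
      rw [rank_fun', hι]
    have h3 := lift_rank_map_le Ψ V
    rw [htop, rank_top, h1] at h3
    have h4 := lt_of_le_of_lt h3 (Cardinal.lift_lt.mpr hV)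
    simp at h4
  obtain ⟨f, hf, hker⟩ := Submodule.exists_le_ker_of_lt_top _ hlt
  have hfe : ∀ z : ι → ℂ, f z = ∑ j, f (Pi.single j 1) * z j := by
    intro z
    conv_lhs => rw [← Finset.univ_sum_single z]
    rw [map_sum]
    refine Finset.sum_congr rfl fun j _ => ?_
    have : Pi.single j (z j) = z j • (Pi.single j 1 : ι → ℂ) := by
      rw [← Pi.single_smul]; simp
    rw [this, map_smul, smul_eq_mul, mul_comm]
  refine ⟨fun j => f (Pi.single j 1), ?_, ?_⟩
  · by_contra hcon
    have h0 : ∑ j, ‖f (Pi.single j 1)‖ = 0 :=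
      le_antisymm (not_lt.mp hcon) (Finset.sum_nonneg fun _ _ => norm_nonneg _)
    rw [Finset.sum_eq_zero_iff_of_nonneg (fun _ _ => norm_nonneg _)] at h0
    apply hf
    ext z
    simp [norm_eq_zero.mp (h0 z (Finset.mem_univ z))]
  · intro y hy
    rw [← hfe]
    exact hker (Submodule.mem_map_of_mem hy)

lemma kol_lower (ρ : 𝒜 →⋆ₙₐ[ℂ] (H →L[ℂ] H)) (hρn : ∀ x, ‖ρ x‖ ≤ ‖x‖) (a : 𝒜) (m : ℕ)
    {ι : Type*} [Fintype ι] [DecidableEq ι] (hι : Fintype.card ι = m + 1)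
    (u v : ι → H) (s : ι → ℝ) (t : ℝ) (ht : 0 ≤ t) (hs : ∀ j, t ≤ s j)
    (hu : ∀ j, ‖u j‖ = 1) (hv : ∀ j, ‖v j‖ = 1)
    (huv : ∀ j, ρ a (u j) = (s j : ℂ) • v j)
    (hx : ∀ ξ : ι → ℂ, (∀ j, ‖ξ j‖ = 1) → ∀ ε > 0,
      ∃ x : 𝒜, ‖x‖ ≤ 2 ∧ ∀ j, ‖ρ x (v j) - ξ j • u j‖ < ε) :
    t ^ 2 ≤ 2 * kolNum (Mop a a) (m + 1) := by
  have hmain : t ^ 2 / 2 ≤ kolNum (Mop a a) (m + 1) := by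
    refine le_csInf (kolNum_set_nonempty _ m) ?_
    rintro c ⟨V, hV, rfl⟩
    let Ψ : 𝒜 →ₗ[ℂ] (ι → ℂ) :=
      { toFun := fun y j => inner ℂ (v j) (ρ y (u j))
        map_add' := by intro x y; ext j; simp [inner_add_right]
        map_smul' := by intro c y; ext j; simp [inner_smul_right] }
    have hΨ : ∀ y j, Ψ y j = inner ℂ (v j) (ρ y (u j)) := fun _ _ => rfl
    have hΨn : ∀ y j, ‖Ψ y j‖ ≤ ‖y‖ := by
      intro y j
      rw [hΨ]
      refine (norm_inner_le_norm _ _).trans ?_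
      rw [hv, one_mul]
      refine ((ρ y).le_opNorm _).trans ?_
      rw [hu, mul_one]
      exact hρn y
    obtain ⟨φ, hA, hφ⟩ := exists_functional m hι Ψ V hV
    set A := ∑ j, ‖φ j‖ with hAdef
    have hbd : BddAbove (Set.range fun x : {x : 𝒜 // ‖x‖ ≤ 1} =>
        ⨅ y : V, ‖(Mop a a) x.1 - (y : 𝒜)‖) := by
      refine ⟨‖Mop a a‖, ?_⟩
      rintro _ ⟨x, rfl⟩
      refine (ciInf_le ⟨0, by rintro _ ⟨y, rfl⟩; exact norm_nonneg _⟩ (0 : V)).trans ?_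
      simp only [ZeroMemClass.coe_zero, sub_zero]
      exact (Mop a a).unit_le_opNorm _ x.2
    have hs0 : ∀ j, 0 ≤ s j := fun j => ht.trans (hs j)
    have hsT : ∀ j, s j ≤ ‖ρ a‖ := by
      intro j
      have := (ρ a).le_opNorm (u j)
      rw [huv, norm_smul, hv, hu] at this
      simpa [abs_of_nonneg (hs0 j)] using this
    choose ξ hξ1 hξ2 using fun j : ι => show ∃ z : ℂ, ‖z‖ = 1 ∧ φ j * z = (‖φ j‖ : ℂ) by
      by_cases h : φ j = 0
      · exact ⟨1, by simp, by simp [h]⟩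
      · have hn : (‖φ j‖ : ℂ) ≠ 0 := by exact_mod_cast (norm_ne_zero_iff.mpr h)
        refine ⟨(‖φ j‖ : ℂ) / φ j, ?_, by field_simp⟩
        rw [norm_div]
        simp [h]
    refine le_of_forall_pos_le_add fun δ hδ => ?_
    obtain ⟨x, hx2, hxe⟩ := hx ξ hξ1 (δ / (‖ρ a‖ ^ 2 + 1)) (by positivity)
    have hδ' : ‖ρ a‖ ^ 2 * (δ / (‖ρ a‖ ^ 2 + 1)) ≤ δ := by
      rw [mul_div_assoc', div_le_iff₀ (by positivity)]
      nlinarith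
    have hr : ∀ j, ‖Ψ (a * x * a) j - (s j : ℂ) ^ 2 * ξ j‖ ≤ δ := by
      intro j
      have e1 : Ψ (a * x * a) j - (s j : ℂ) ^ 2 * ξ j =
          (s j : ℂ) * inner ℂ (v j) (ρ a (ρ x (v j) - ξ j • u j)) := by
        have hvv : inner ℂ (v j) (v j) = (1 : ℂ) := by
          rw [inner_self_eq_norm_sq_to_K, hv]; simp
        rw [hΨ, map_mul, map_mul, mul_apply_eq_comp, mul_apply_eq_comp, huv, map_smul, map_smul,
          map_sub, map_smul, huv, inner_sub_right, inner_smul_right, inner_smul_right,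
          inner_smul_right, hvv]
        ring
      rw [e1, norm_mul]
      have e2 : ‖inner ℂ (v j) (ρ a (ρ x (v j) - ξ j • u j))‖ ≤
          ‖ρ a‖ * (δ / (‖ρ a‖ ^ 2 + 1)) := by
        refine (norm_inner_le_norm _ _).trans ?_
        rw [hv, one_mul]
        refine ((ρ a).le_opNorm _).trans ?_
        gcongr
        exact (hxe j).le
      have e3 : ‖(s j : ℂ)‖ ≤ ‖ρ a‖ := by
        rw [Complex.norm_real, Real.norm_eq_abs, abs_of_nonneg (hs0 j)]
        exact hsT j
      calc _ ≤ ‖ρ a‖ * (‖ρ a‖ * (δ / (‖ρ a‖ ^ 2 + 1))) := by gcongr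
        _ = ‖ρ a‖ ^ 2 * (δ / (‖ρ a‖ ^ 2 + 1)) := by ring
        _ ≤ δ := hδ'
    have hlow : A * (t ^ 2 - δ) ≤ ‖∑ j, φ j * Ψ (a * x * a) j‖ := by
      have e1 : ∑ j, φ j * Ψ (a * x * a) j = ((∑ j, ‖φ j‖ * s j ^ 2 : ℝ) : ℂ) +
          ∑ j, φ j * (Ψ (a * x * a) j - (s j : ℂ) ^ 2 * ξ j) := by
        push_cast
        rw [← Finset.sum_add_distrib]
        refine Finset.sum_congr rfl fun j _ => ?_
        rw [← hξ2 j]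
        ring
      have e2 : ‖∑ j, φ j * (Ψ (a * x * a) j - (s j : ℂ) ^ 2 * ξ j)‖ ≤ A * δ := by
        refine (norm_sum_le _ _).trans ?_
        rw [hAdef, Finset.sum_mul]
        refine Finset.sum_le_sum fun j _ => ?_
        rw [norm_mul]
        exact mul_le_mul_of_nonneg_left (hr j) (norm_nonneg _)
      have e3 : A * t ^ 2 ≤ ∑ j, ‖φ j‖ * s j ^ 2 := by
        rw [hAdef, Finset.sum_mul]
        refine Finset.sum_le_sum fun j _ => ?_
        exact mul_le_mul_of_nonneg_left (pow_le_pow_left₀ ht (hs j) 2) (norm_nonneg _)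
      rw [e1]
      have e4 := norm_sub_le_norm_add ((∑ j, ‖φ j‖ * s j ^ 2 : ℝ) : ℂ)
        (∑ j, φ j * (Ψ (a * x * a) j - (s j : ℂ) ^ 2 * ξ j))
      rw [Complex.norm_real, Real.norm_eq_abs] at e4
      have e5 := le_abs_self (∑ j, ‖φ j‖ * s j ^ 2)
      linarith
    have hhalf : ‖(2⁻¹ : ℂ) • x‖ ≤ 1 := by
      rw [norm_smul]
      norm_num
      linarith
    have hinf : (t ^ 2 - δ) / 2 ≤ ⨅ y : V, ‖(Mop a a) ((2⁻¹ : ℂ) • x) - (y : 𝒜)‖ := by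
      refine le_ciInf fun y => ?_
      have e1 : (Mop a a) ((2⁻¹ : ℂ) • x) = (2⁻¹ : ℂ) • (a * x * a) := by
        rw [map_smul]
        simp [Mop, mul_assoc]
      have e2 : ∑ j, φ j * Ψ ((2⁻¹ : ℂ) • (a * x * a) - (y : 𝒜)) j =
          (2⁻¹ : ℂ) * ∑ j, φ j * Ψ (a * x * a) j := by
        have := hφ y y.2
        rw [Finset.mul_sum, ← sub_zero (∑ j, (2⁻¹ : ℂ) * _), ← this, ← Finset.sum_sub_distrib]
        refine Finset.sum_congr rfl fun j _ => ?_
        rw [map_sub, map_smul]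
        simp only [Pi.sub_apply, Pi.smul_apply, smul_eq_mul]
        ring
      have e3 : ‖∑ j, φ j * Ψ ((2⁻¹ : ℂ) • (a * x * a) - (y : 𝒜)) j‖ ≤
          A * ‖(2⁻¹ : ℂ) • (a * x * a) - (y : 𝒜)‖ := by
        refine (norm_sum_le _ _).trans ?_
        rw [hAdef, Finset.sum_mul]
        refine Finset.sum_le_sum fun j _ => ?_
        rw [norm_mul]
        exact mul_le_mul_of_nonneg_left (hΨn _ j) (norm_nonneg _)
      rw [e2, norm_mul] at e3
      rw [e1]
      have e4 : ‖(2⁻¹ : ℂ)‖ = 2⁻¹ := by norm_num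
      rw [e4] at e3
      refine le_of_mul_le_mul_left ?_ hA
      linarith
    have := le_ciSup hbd ⟨(2⁻¹ : ℂ) • x, hhalf⟩
    simp only at this
    linarith
  linarith

end kol


section atomic
variable {𝒜 : Type*} [NonUnitalCStarAlgebra 𝒜]
    {I : Type*} {Hi : I → Type*} [∀ i, NormedAddCommGroup (Hi i)]
    [∀ i, InnerProductSpace ℂ (Hi i)] [∀ i, CompleteSpace (Hi i)]

lemma lp_commutant [DecidableEq I]
    (ρi : ∀ i, 𝒜 →⋆ₙₐ[ℂ] (Hi i →L[ℂ] Hi i))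
    (hirr : ∀ i, ∀ V : Submodule ℂ (Hi i), IsClosed (V : Set (Hi i)) →
        (∀ x : 𝒜, ∀ v ∈ V, ρi i x v ∈ V) → V = ⊥ ∨ V = ⊤)
    (hineq : ∀ i j, i ≠ j →
      ¬ ∃ U : Hi i ≃ₗᵢ[ℂ] Hi j, ∀ (x : 𝒜) (v : Hi i), U (ρi i x v) = ρi j x (U v))
    (ρ : 𝒜 →⋆ₙₐ[ℂ] (lp Hi 2 →L[ℂ] lp Hi 2))
    (hρ : ∀ (x : 𝒜) (v : lp Hi 2) (i : I), (ρ x v : ∀ i, Hi i) i = ρi i x (v i))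
    (C : lp Hi 2 →L[ℂ] lp Hi 2) (hC : ∀ x, Commute (ρ x) C) (i : I) :
    ∃ c : ℂ, ∀ v : lp Hi 2, (C v : ∀ i, Hi i) i = c • (v : ∀ i, Hi i) i := by
  let E : ∀ j, Hi j →L[ℂ] Hi i := fun j =>
    (lp.evalCLM ℂ Hi 2 i ∘L C) ∘L lp.singleContinuousLinearMap ℂ Hi 2 j
  have hE : ∀ j b, E j b = (C (lp.single 2 j b) : ∀ i, Hi i) i := fun _ _ => rfl
  have hsingle : ∀ x j (b : Hi j), ρ x (lp.single 2 j b) = lp.single 2 j (ρi j x b) := by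
    intro x j b
    have := block_single (ρ x) (fun i => ρi i x) (hρ x) (lp.single 2 j b) j
    rw [hρ, lp.single_apply_self] at this
    exact this
  have hEi : ∀ j x b, E j (ρi j x b) = ρi i x (E j b) := by
    intro j x b
    rw [hE, hE, ← hsingle, ← hρ]
    have := congrArg (fun S : lp Hi 2 →L[ℂ] lp Hi 2 => S (lp.single 2 j b)) (hC x)
    simp only [mul_apply_eq_comp] at this
    rw [this]
  obtain ⟨c, hc⟩ := schur_scalar (ρi i) (hirr i) (E i) (fun x => by
    ext b
    rw [mul_apply_eq_comp, mul_apply_eq_comp, hEi])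
  refine ⟨c, fun v => ?_⟩
  have h1 := (lp.hasSum_single (p := 2) (by norm_num) v).mapL (lp.evalCLM ℂ Hi 2 i ∘L C)
  have h2 : HasSum (fun j => E j (v j)) ((C v : ∀ i, Hi i) i) := h1
  have h3 : HasSum (fun j => E j (v j)) (E i (v i)) := by
    apply hasSum_single
    intro j hj
    rw [schur_intertwiner (ρi j) (ρi i) (hirr j) (hirr i) (hineq j i hj) (E j) (hEi j)]
    rfl
  rw [h2.unique h3, hc]
  rfl

lemma lp_nondegenerate
    (ρi : ∀ i, 𝒜 →⋆ₙₐ[ℂ] (Hi i →L[ℂ] Hi i))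
    (hirr : ∀ i, (∃ x : 𝒜, ρi i x ≠ 0) ∧
      ∀ V : Submodule ℂ (Hi i), IsClosed (V : Set (Hi i)) →
        (∀ x : 𝒜, ∀ v ∈ V, ρi i x v ∈ V) → V = ⊥ ∨ V = ⊤)
    (ρ : 𝒜 →⋆ₙₐ[ℂ] (lp Hi 2 →L[ℂ] lp Hi 2))
    (hρ : ∀ (x : 𝒜) (v : lp Hi 2) (i : I), (ρ x v : ∀ i, Hi i) i = ρi i x (v i))
    (v : lp Hi 2) (hv : ∀ x, ρ x v = 0) : v = 0 := by
  ext i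
  let N : Submodule ℂ (Hi i) := ⨅ x : 𝒜, LinearMap.ker (ρi i x : Hi i →ₗ[ℂ] Hi i)
  have hN : ∀ w, w ∈ N ↔ ∀ x, ρi i x w = 0 := by
    intro w
    simp [N, Submodule.mem_iInf]
  have hcl : IsClosed (N : Set (Hi i)) := by
    have : (N : Set (Hi i)) = ⋂ x : 𝒜, {w | ρi i x w = 0} := by
      ext w
      simp [hN]
    rw [this]
    exact isClosed_iInter fun x => isClosed_eq (ρi i x).continuous continuous_const
  have hz : (v : ∀ i, Hi i) i ∈ N := by
    rw [hN]
    intro x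
    rw [← hρ, hv]
    rfl
  rcases (hirr i).2 N hcl (by
    intro x w hw
    rw [(hN w).1 hw x]
    exact N.zero_mem) with h | h
  · rw [h] at hz
    simpa using hz
  · obtain ⟨x, hx⟩ := (hirr i).1
    refine absurd ?_ hx
    ext w
    exact (hN w).1 (h ▸ Submodule.mem_top) x

lemma norm_sum_orthonormal_le {H : Type*} [NormedAddCommGroup H] [InnerProductSpace ℂ H]
    {ι : Type*} [Fintype ι] (u v : ι → H) (hu : Orthonormal ℂ u) (hv : Orthonormal ℂ v)
    (ξ : ι → ℂ) (hξ : ∀ j, ‖ξ j‖ = 1) :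
    ‖∑ j, ξ j • (innerSL ℂ (v j)).smulRight (u j)‖ ≤ 1 := by
  refine ContinuousLinearMap.opNorm_le_bound _ zero_le_one fun x => ?_
  have h1 : (∑ j, ξ j • (innerSL ℂ (v j)).smulRight (u j)) x =
      ∑ j, (ξ j * inner ℂ (v j) x) • u j := by
    rw [ContinuousLinearMap.sum_apply]
    refine Finset.sum_congr rfl fun j _ => ?_
    simp [smul_smul]
  rw [h1, one_mul]
  refine le_of_sq_le_sq ?_ (norm_nonneg _)
  refine le_trans (le_of_eq ?_) (hv.sum_inner_products_le x (s := Finset.univ))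
  have h2 := hu.inner_sum (fun j => ξ j * inner ℂ (v j) x) (fun j => ξ j * inner ℂ (v j) x)
    Finset.univ
  rw [inner_self_eq_norm_sq_to_K] at h2
  have h3 : ((‖∑ j, (ξ j * inner ℂ (v j) x) • u j‖ ^ 2 : ℝ) : ℂ) =
      ((∑ j, ‖(inner ℂ (v j) x : ℂ)‖ ^ 2 : ℝ) : ℂ) := by
    push_cast
    refine h2.trans ?_
    refine Finset.sum_congr rfl fun j _ => ?_
    rw [Complex.conj_mul', norm_mul, hξ, one_mul]
  exact_mod_cast h3

lemma atomic_bound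
    (ρi : ∀ i, 𝒜 →⋆ₙₐ[ℂ] (Hi i →L[ℂ] Hi i))
    (hirr : ∀ i, (∃ x : 𝒜, ρi i x ≠ 0) ∧
      ∀ V : Submodule ℂ (Hi i), IsClosed (V : Set (Hi i)) →
        (∀ x : 𝒜, ∀ v ∈ V, ρi i x v ∈ V) → V = ⊥ ∨ V = ⊤)
    (hineq : ∀ i j, i ≠ j →
      ¬ ∃ U : Hi i ≃ₗᵢ[ℂ] Hi j, ∀ (x : 𝒜) (v : Hi i), U (ρi i x v) = ρi j x (U v))
    (ρ : 𝒜 →⋆ₙₐ[ℂ] (lp Hi 2 →L[ℂ] lp Hi 2))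
    (hρ : ∀ (x : 𝒜) (v : lp Hi 2) (i : I), (ρ x v : ∀ i, Hi i) i = ρi i x (v i))
    (a : 𝒜) (m : ℕ) (t : ℝ) (ht : 0 ≤ t) (hta : t < approxNum (ρ a) (2 * m + 1)) :
    t ^ 2 ≤ 2 * kolNum (Mop a a) (m + 1) := by
  classical
  obtain ⟨s, hcard, hs1, hs2⟩ := greedy (ρ a) (fun i => ρi i a) (hρ a) t ht m hta (m + 1) le_rfl
  let u : s → lp Hi 2 := fun j => j.1
  let σ : s → ℝ := fun j => ‖ρ a (u j)‖
  have hσt : ∀ j, t < σ j := fun j => (hs1 j.1 j.2).2.2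
  have hσ0 : ∀ j, 0 < σ j := fun j => lt_of_le_of_lt ht (hσt j)
  have hσc : ∀ j, (σ j : ℂ) ≠ 0 := fun j => by exact_mod_cast (hσ0 j).ne'
  let v : s → lp Hi 2 := fun j => ((σ j : ℂ)⁻¹) • ρ a (u j)
  have hun : ∀ j, ‖u j‖ = 1 := fun j => (hs1 j.1 j.2).2.1
  have hvn : ∀ j, ‖v j‖ = 1 := by
    intro j
    simp only [v, norm_smul, norm_inv, Complex.norm_real, Real.norm_eq_abs,
      abs_of_pos (hσ0 j)]
    exact inv_mul_cancel₀ (hσ0 j).ne'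
  have huo : Orthonormal ℂ u := by
    refine ⟨hun, fun j k hjk => ?_⟩
    exact (hs2 j.1 j.2 k.1 k.2 (fun h => hjk (Subtype.ext h))).1
  have hvo : Orthonormal ℂ v := by
    refine ⟨hvn, fun j k hjk => ?_⟩
    have := (hs2 j.1 j.2 k.1 k.2 (fun h => hjk (Subtype.ext h))).2
    simp only [v, inner_smul_left, inner_smul_right]
    change _ * (_ * inner ℂ (ρ a j.1) (ρ a k.1)) = 0
    rw [this]
    simp
  have hhom : ∀ j, ∃ i, ∃ b c : Hi i, u j = lp.single 2 i b ∧ v j = lp.single 2 i c := by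
    intro j
    obtain ⟨i, b, hb⟩ := (hs1 j.1 j.2).1
    refine ⟨i, b, (σ j : ℂ)⁻¹ • ρi i a b, hb, ?_⟩
    have h1 := block_single (ρ a) (fun i => ρi i a) (hρ a) (lp.single 2 i b) i
    rw [hρ, lp.single_apply_self] at h1
    have hb2 : u j = lp.single 2 i b := hb
    change (σ j : ℂ)⁻¹ • ρ a (u j) = _
    rw [lp.single_smul, ← h1, hb2]
  refine kol_lower ρ (fun x => NonUnitalStarAlgHom.norm_apply_le ρ x) a m
    (by rw [Fintype.card_coe, hcard]) u v σ t ht (fun j => (hσt j).le) hun hvn ?_ ?_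
  · intro j
    simp only [v]
    rw [smul_smul, mul_inv_cancel₀ (hσc j), one_smul]
  · intro ξ hξ ε hε
    have hBv : ∀ w, (∑ j, ξ j • (innerSL ℂ (v j)).smulRight (u j)) w =
        ∑ j, (ξ j * inner ℂ (v j) w) • u j := by
      intro w
      rw [ContinuousLinearMap.sum_apply]
      refine Finset.sum_congr rfl fun j _ => ?_
      simp [smul_smul]
    obtain ⟨x, hx, hxe⟩ := kaplansky_two ρ (lp_nondegenerate ρi hirr ρ hρ)
      (∑ j, ξ j • (innerSL ℂ (v j)).smulRight (u j))
      (norm_sum_orthonormal_le u v huo hvo ξ hξ) (by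
        intro C hC
        choose c hc using lp_commutant ρi (fun i => (hirr i).2) hineq ρ hρ C hC
        ext1 w
        rw [mul_apply_eq_comp, mul_apply_eq_comp, hBv, hBv, map_sum]
        refine Finset.sum_congr rfl fun j _ => ?_
        obtain ⟨i, b, d, hb, hd⟩ := hhom j
        have e1 : inner ℂ (v j) (C w) = c i * inner ℂ (v j) w := by
          rw [hd, lp.inner_single_left, lp.inner_single_left, hc, inner_smul_right]
        have e2 : C (u j) = c i • u j := by
          rw [hb]
          ext k
          rw [hc]
          by_cases hk : k = i
          · subst hk
            rfl
          · rw [lp.coeFn_smul, Pi.smul_apply, lp.single_apply_ne _ _ _ hk, smul_zero, smul_zero]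
        rw [map_smul, e1, e2, smul_smul]
        congr 1
        ring) v ε hε
    refine ⟨x, hx, fun j => ?_⟩
    have := hxe j
    rw [hBv] at this
    have e : ∑ k, (ξ k * inner ℂ (v k) (v j)) • u k = ξ j • u j := by
      rw [Finset.sum_eq_single j]
      · rw [inner_self_eq_norm_sq_to_K, hvn]
        simp
      · intro k _ hk
        rw [hvo.2 hk]
        simp
      · simp
    rwa [e] at this

lemma atomic_bound_sq
    (ρi : ∀ i, 𝒜 →⋆ₙₐ[ℂ] (Hi i →L[ℂ] Hi i))
    (hirr : ∀ i, (∃ x : 𝒜, ρi i x ≠ 0) ∧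
      ∀ V : Submodule ℂ (Hi i), IsClosed (V : Set (Hi i)) →
        (∀ x : 𝒜, ∀ v ∈ V, ρi i x v ∈ V) → V = ⊥ ∨ V = ⊤)
    (hineq : ∀ i j, i ≠ j →
      ¬ ∃ U : Hi i ≃ₗᵢ[ℂ] Hi j, ∀ (x : 𝒜) (v : Hi i), U (ρi i x v) = ρi j x (U v))
    (ρ : 𝒜 →⋆ₙₐ[ℂ] (lp Hi 2 →L[ℂ] lp Hi 2))
    (hρ : ∀ (x : 𝒜) (v : lp Hi 2) (i : I), (ρ x v : ∀ i, Hi i) i = ρi i x (v i))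
    (a : 𝒜) (m : ℕ) :
    approxNum (ρ a) (2 * m + 1) ^ 2 ≤ 2 * kolNum (Mop a a) (m + 1) := by
  have hk := kolNum_nonneg (Mop a a) (m + 1)
  have : approxNum (ρ a) (2 * m + 1) ≤ √(2 * kolNum (Mop a a) (m + 1)) := by
    refine le_of_forall_lt fun t htlt => ?_
    obtain ⟨r, hr1, hr2⟩ := exists_between htlt
    rcases le_or_gt 0 r with h0 | h0
    · exact lt_of_lt_of_le hr1
        (Real.le_sqrt_of_sq_le (atomic_bound ρi hirr hineq ρ hρ a m r h0 hr2))
    · exact lt_of_lt_of_le (hr1.trans h0) (Real.sqrt_nonneg _)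
  calc _ ≤ √(2 * kolNum (Mop a a) (m + 1)) ^ 2 :=
        pow_le_pow_left₀ (approxNum_nonneg _ _) this 2
    _ = _ := Real.sq_sqrt (by positivity)

end atomic

/-- quantitative version of Ylinen's theorem.  Let `𝒜` be a
C*-algebra and `(ρᵢ, Hᵢ)_{i∈I}` a maximal family of pairwise unitarily inequivalent
irreducible *-representations of `𝒜`; let `ρ = ⊕ᵢ ρᵢ` on the Hilbert sum `⊕ᵢ Hᵢ`
(the reduced atomic representation).  If `a ∈ 𝒜` and `𝔦` is a Calkin space with
`(dₙ(M_{a,a}))ₙ ∈ 𝔦`, then `ρ(a)` is compact and `(sₙ(ρ(a))²)ₙ ∈ 𝔦`. -/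
theorem reducedAtomic_sq_mem {𝒜 : Type u} [NonUnitalNormedRing 𝒜] [StarRing 𝒜]
    [CStarRing 𝒜] [NormedSpace ℂ 𝒜] [IsScalarTower ℂ 𝒜 𝒜] [SMulCommClass ℂ 𝒜 𝒜]
    [StarModule ℂ 𝒜] [CompleteSpace 𝒜]
    {I : Type v} (Hi : I → Type w) [∀ i, NormedAddCommGroup (Hi i)]
    [∀ i, InnerProductSpace ℂ (Hi i)] [∀ i, CompleteSpace (Hi i)]
    (ρi : ∀ i, 𝒜 →⋆ₙₐ[ℂ] (Hi i →L[ℂ] Hi i))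
    -- each `ρᵢ` is a nonzero irreducible representation:
    (hirr : ∀ i, (∃ x : 𝒜, ρi i x ≠ 0) ∧
      ∀ V : Submodule ℂ (Hi i), IsClosed (V : Set (Hi i)) →
        (∀ x : 𝒜, ∀ v ∈ V, ρi i x v ∈ V) → V = ⊥ ∨ V = ⊤)
    -- the `ρᵢ` are pairwise unitarily inequivalent:
    (hineq : ∀ i j, i ≠ j →
      ¬ ∃ U : Hi i ≃ₗᵢ[ℂ] Hi j, ∀ (x : 𝒜) (v : Hi i), U (ρi i x v) = ρi j x (U v))
    -- the family is maximal: every nonzero irreducible *-representation of `𝒜` is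
    -- unitarily equivalent to some `ρᵢ`:
    (hmax : ∀ (K : Type w) [NormedAddCommGroup K] [InnerProductSpace ℂ K]
      [CompleteSpace K] (π : 𝒜 →⋆ₙₐ[ℂ] (K →L[ℂ] K)),
      ((∃ x : 𝒜, π x ≠ 0) ∧
        ∀ V : Submodule ℂ K, IsClosed (V : Set K) →
          (∀ x : 𝒜, ∀ v ∈ V, π x v ∈ V) → V = ⊥ ∨ V = ⊤) →
      ∃ (i : I) (U : K ≃ₗᵢ[ℂ] Hi i), ∀ (x : 𝒜) (v : K), U (π x v) = ρi i x (U v))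
    -- `ρ` is the direct sum of the `ρᵢ`, acting on the Hilbert sum `⊕ᵢ Hᵢ`:
    (ρ : 𝒜 →⋆ₙₐ[ℂ] (lp Hi 2 →L[ℂ] lp Hi 2))
    (hρ : ∀ (x : 𝒜) (v : lp Hi 2) (i : I), (ρ x v : ∀ i, Hi i) i = ρi i x (v i))
    (a : 𝒜) (J : Set (ℕ → ℂ)) (hJ : IsCalkinSpace J)
    (hd : toC (fun n => kolNum (Mop a a) (n + 1)) ∈ J) :
    IsCompactOperator ⇑(ρ a) ∧
      toC (fun n => (approxNum (ρ a) (n + 1)) ^ 2) ∈ J := by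
  letI : NonUnitalCStarAlgebra 𝒜 := {}
  have hb : ∀ m, approxNum (ρ a) (2 * m + 1) ^ 2 ≤ 2 * kolNum (Mop a a) (m + 1) :=
    atomic_bound_sq ρi hirr hineq ρ hρ a
  have hmem : toC (fun n => (approxNum (ρ a) (n + 1)) ^ 2) ∈ J := by
    refine calkin_mem_of_half J hJ (fun n => kolNum (Mop a a) (n + 1)) _ hd
      (kolNum_antitone _) (fun n => kolNum_nonneg _ _) ?_ (fun n => sq_nonneg _) ?_
    · intro m n hmn
      exact pow_le_pow_left₀ (approxNum_nonneg _ _) (approxNum_antitone (ρ a) hmn) 2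
    · intro n
      refine le_trans ?_ (hb (n / 2))
      exact pow_le_pow_left₀ (approxNum_nonneg _ _)
        (approxNum_antitone (ρ a) (show 2 * (n / 2) ≤ n by omega)) 2
  refine ⟨isCompactOperator_of_approxNum _ ?_, hmem⟩
  have h0 : Filter.Tendsto (toC (fun n => (approxNum (ρ a) (n + 1)) ^ 2)) Filter.atTop (nhds 0) :=
    hJ.1 hmem
  have h1 := h0.norm
  have h2 := h1.sqrt
  have h3 : (fun n => √‖toC (fun n => (approxNum (ρ a) (n + 1)) ^ 2) n‖) =
      fun n => approxNum (ρ a) (n + 1) := by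
    funext n
    simp only [toC, Complex.norm_real, norm_pow, Real.norm_eq_abs, sq_abs]
    exact Real.sqrt_sq (approxNum_nonneg _ _)
  rw [h3] at h2
  simpa using h2
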